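/- Let (X, μ, T) be a non-trivial ergodic subshift and S a self-homeomorphism with almost weak specification of a compact metric space Y, with h_μ(T) < h_top(S). Let ξ ∈ M_0 and let V be a weak*-neighbourhood of ξ in M_0. Then there exists ξ' ∈ V with h_{π_2^*(ξ')}(S) > h_μ(T) (strict inequality). -/

import Mathlib

open MeasureTheory Filter Set
open scoped ENNReal

/-- Shannon entropy of the finite-valued observable `P` with respect to `μ`. -/
noncomputable def infoEntropy {X : Type*} [MeasurableSpace X] (μ : Measure X)
    {α : Type*} [Fintype α] (P : X → α) : ℝ :=
  ∑ a : α, Real.negMulLog (μ (P ⁻¹' {a})).toReal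

/-- Entropy of the transformation `T` with respect to the observable (finite partition) `P`. -/
noncomputable def entropyWrt {X : Type*} [MeasurableSpace X] (μ : Measure X) (T : X → X)
    {α : Type*} [Fintype α] (P : X → α) : ℝ :=
  Filter.atTop.liminf fun n : ℕ =>
    infoEntropy μ (fun x => fun i : Fin n => P (T^[(i : ℕ)] x)) / n

/-- Kolmogorov–Sinai (measure-theoretic) entropy of `T` with respect to `μ`. -/
noncomputable def ksEntropy {X : Type*} [MeasurableSpace X] (μ : Measure X) (T : X → X) : ℝ≥0∞ :=
  ⨆ (k : ℕ) (P : X → Fin k) (_ : Measurable P), ENNReal.ofReal (entropyWrt μ T P)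

/-- Topological entropy (Bowen–Dinaburg, via dynamical covers). -/
noncomputable def topEntropy {Y : Type*} [UniformSpace Y] (S : Y → Y) : EReal :=
  Dynamics.coverEntropy S Set.univ

/-- `L` is a gap function for the invertible system `S` at scale `ε`. -/
def IsGapFunction {Y : Type*} [MetricSpace Y] (S : Y ≃ Y) (ε : ℝ) (L : ℕ → ℕ) : Prop :=
  Monotone L ∧ (∀ m, 0 < L m) ∧
    ∀ (n : ℕ) (y : Fin n → Y) (a b : Fin n → ℤ),
      (∀ i, a i ≤ b i) →
      (∀ i j : Fin n, (i : ℕ) + 1 = (j : ℕ) → (L (b j - a j).toNat : ℤ) ≤ a j - b i) →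
      ∃ z : Y, ∀ (i : Fin n) (kk : ℤ), a i ≤ kk → kk ≤ b i →
        dist ((S ^ kk) z) ((S ^ kk) (y i)) ≤ ε

/-- Almost weak specification: for every `ε > 0` there is a sublinear gap function. -/
def AlmostWeakSpec {Y : Type*} [MetricSpace Y] (S : Y ≃ Y) : Prop :=
  ∀ ε : ℝ, 0 < ε → ∃ L : ℕ → ℕ, IsGapFunction S ε L ∧
    Filter.Tendsto (fun m : ℕ => (L m : ℝ) / m) Filter.atTop (nhds 0)

/-- A measure on a topological space has full support. -/
def FullSupport {Y : Type*} [TopologicalSpace Y] [MeasurableSpace Y] (ν : Measure Y) : Prop :=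
  ∀ U : Set Y, IsOpen U → U.Nonempty → 0 < ν U

/-- The shift map on bi-infinite sequences. -/
def fullShift {A : Type*} : (ℤ → A) → (ℤ → A) := fun x n => x (n + 1)

noncomputable instance (k : ℕ) : MetricSpace (Fin k) :=
  MetricSpace.induced (fun i : Fin k => (i : ℝ))
    (fun a b h => Fin.val_injective (Nat.cast_injective h)) inferInstance

/-- The standard metric on the full shift over a finite alphabet. -/
noncomputable instance (k : ℕ) : MetricSpace (ℤ → Fin k) := PiCountable.metricSpace

instance (k : ℕ) : MeasurableSpace (ℤ → Fin k) := borel _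
instance (k : ℕ) : BorelSpace (ℤ → Fin k) := ⟨rfl⟩

/-- The space `M₀` of ergodic `μ`-joinings `ξ` of `(Xs, μ, σX)` and `(Y, S)` satisfying
`h_{π₂*ξ}(S) ≥ h_μ(σX)`. -/
def joiningM0 {k : ℕ} (Xs : Set (ℤ → Fin k)) (σX : ↥Xs ≃ ↥Xs) (μ : Measure ↥Xs)
    {Y : Type*} [MetricSpace Y] [MeasurableSpace Y] (S : Y ≃ₜ Y) :
    Set (ProbabilityMeasure (↥Xs × Y)) :=
  {ξ | (ξ : Measure (↥Xs × Y)).map Prod.fst = μ ∧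
    Ergodic (Prod.map (⇑σX) (⇑S)) (ξ : Measure (↥Xs × Y)) ∧
    ksEntropy μ (⇑σX) ≤ ksEntropy ((ξ : Measure (↥Xs × Y)).map Prod.snd) (⇑S)}

open scoped BoundedContinuousFunction

section Entropy

variable {Ω : Type*} [MeasurableSpace Ω] {μ : Measure Ω}
variable {α β γ : Type*} [Fintype α] [Fintype β]

theorem infoEntropy_congr_ae {f g : Ω → α} (h : f =ᵐ[μ] g) :
    infoEntropy μ f = infoEntropy μ g := by
  refine Finset.sum_congr rfl fun a _ => ?_
  congr 2
  refine measure_congr ?_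
  filter_upwards [h] with x hx
  exact congrArg (· = a) hx

theorem infoEntropy_nonneg [IsProbabilityMeasure μ] (f : Ω → α) : 0 ≤ infoEntropy μ f :=
  Finset.sum_nonneg fun _ _ => Real.negMulLog_nonneg ENNReal.toReal_nonneg
    (ENNReal.toReal_mono ENNReal.one_ne_top prob_le_one)

theorem infoEntropy_map {Ω' : Type*} [MeasurableSpace Ω'] {φ : Ω → Ω'} (hφ : Measurable φ)
    [MeasurableSpace α] [MeasurableSingletonClass α] {f : Ω' → α} (hf : Measurable f) :
    infoEntropy (μ.map φ) f = infoEntropy μ (f ∘ φ) := by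
  refine Finset.sum_congr rfl fun a _ => ?_
  rw [Measure.map_apply hφ (hf (measurableSet_singleton a)), preimage_comp]

theorem infoEntropy_comp_measurePreserving {T : Ω → Ω} (hT : MeasurePreserving T μ μ)
    [MeasurableSpace α] [MeasurableSingletonClass α] {f : Ω → α} (hf : Measurable f) :
    infoEntropy μ (f ∘ T) = infoEntropy μ f := by
  rw [← infoEntropy_map hT.measurable hf, hT.map_eq]

theorem sum_measure_preimage_singleton_toReal [IsProbabilityMeasure μ]
    [MeasurableSpace α] [MeasurableSingletonClass α] {f : Ω → α} (hf : Measurable f) :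
    ∑ a, (μ (f ⁻¹' {a})).toReal = 1 := by
  rw [← ENNReal.toReal_sum (fun a _ => measure_ne_top _ _),
    sum_measure_preimage_singleton _ fun a _ => hf (measurableSet_singleton a)]
  simp

theorem negMulLog_le_sub_sub_mul_log {p q : ℝ} (hp : 0 ≤ p) (hq : 0 ≤ q) (h : q = 0 → p = 0) :
    Real.negMulLog p ≤ q - p - p * Real.log q := by
  rcases hp.eq_or_lt with rfl | hp
  · simpa using hq
  · have hq : 0 < q := hq.lt_of_ne fun h' => hp.ne' (h h'.symm)
    have := Real.log_le_sub_one_of_pos (div_pos hq hp)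
    rw [Real.log_div hq.ne' hp.ne'] at this
    have h2 := mul_le_mul_of_nonneg_left this hp.le
    have h3 : p * (q / p - 1) = q - p := by field_simp
    rw [Real.negMulLog]
    nlinarith

theorem infoEntropy_comp_le [IsProbabilityMeasure μ]
    [MeasurableSpace α] [MeasurableSingletonClass α] {f : Ω → α} (hf : Measurable f)
    (g : α → β) : infoEntropy μ (g ∘ f) ≤ infoEntropy μ f := by
  classical
  have key : ∀ b, Real.negMulLog (μ ((g ∘ f) ⁻¹' {b})).toReal ≤
      ∑ a ∈ Finset.univ.filter (g · = b), Real.negMulLog (μ (f ⁻¹' {a})).toReal := by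
    intro b
    have h1 : (μ ((g ∘ f) ⁻¹' {b})).toReal
        = ∑ a ∈ Finset.univ.filter (g · = b), (μ (f ⁻¹' {a})).toReal := by
      rw [← ENNReal.toReal_sum (fun a _ => measure_ne_top _ _),
        sum_measure_preimage_singleton _ fun a _ => hf (measurableSet_singleton a)]
      congr 2
      ext x
      simp
    rw [Real.negMulLog, neg_mul, h1, Finset.sum_mul, ← Finset.sum_neg_distrib]
    refine Finset.sum_le_sum fun a ha => ?_
    rw [Real.negMulLog, neg_mul]
    rcases (ENNReal.toReal_nonneg : 0 ≤ (μ (f ⁻¹' {a})).toReal).eq_or_lt with h0 | h0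
    · simp [← h0]
    refine neg_le_neg (mul_le_mul_of_nonneg_left (Real.log_le_log h0 ?_) h0.le)
    exact Finset.single_le_sum (f := fun a => (μ (f ⁻¹' {a})).toReal)
      (fun _ _ => ENNReal.toReal_nonneg) ha
  calc infoEntropy μ (g ∘ f) ≤ ∑ b, ∑ a ∈ Finset.univ.filter (g · = b),
        Real.negMulLog (μ (f ⁻¹' {a})).toReal := Finset.sum_le_sum fun b _ => key b
    _ = infoEntropy μ f := Finset.sum_fiberwise _ _ _

theorem infoEntropy_le_of_ae_eq_comp [IsProbabilityMeasure μ]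
    [MeasurableSpace α] [MeasurableSingletonClass α] {f : Ω → α} (hf : Measurable f)
    {h : Ω → β} (g : α → β) (hg : ∀ᵐ x ∂μ, h x = g (f x)) :
    infoEntropy μ h ≤ infoEntropy μ f := by
  rw [infoEntropy_congr_ae (g := g ∘ f) hg]
  exact infoEntropy_comp_le hf g

theorem infoEntropy_le_log_card [IsProbabilityMeasure μ] [Nonempty α]
    [MeasurableSpace α] [MeasurableSingletonClass α] {f : Ω → α} (hf : Measurable f) :
    infoEntropy μ f ≤ Real.log (Fintype.card α) := by
  have hc : (0 : ℝ) < Fintype.card α := by exact_mod_cast Fintype.card_pos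
  have : infoEntropy μ f ≤ ∑ a : α, ((Fintype.card α : ℝ)⁻¹ - (μ (f ⁻¹' {a})).toReal
      - (μ (f ⁻¹' {a})).toReal * Real.log (Fintype.card α : ℝ)⁻¹) :=
    Finset.sum_le_sum fun a _ => negMulLog_le_sub_sub_mul_log ENNReal.toReal_nonneg
      (by positivity) fun h => absurd h (by positivity)
  refine this.trans_eq ?_
  rw [Finset.sum_sub_distrib, Finset.sum_sub_distrib, ← Finset.sum_mul,
    sum_measure_preimage_singleton_toReal hf, Real.log_inv]
  simp [hc.ne']

theorem infoEntropy_prodMk_le [IsProbabilityMeasure μ]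
    [MeasurableSpace α] [MeasurableSingletonClass α] [MeasurableSpace β]
    [MeasurableSingletonClass β] {f : Ω → α} (hf : Measurable f) {g : Ω → β} (hg : Measurable g) :
    infoEntropy μ (fun x => (f x, g x)) ≤ infoEntropy μ f + infoEntropy μ g := by
  set p : α → ℝ := fun a => (μ (f ⁻¹' {a})).toReal with hp
  set q : β → ℝ := fun b => (μ (g ⁻¹' {b})).toReal with hq
  set r : α → β → ℝ := fun a b => (μ ((fun x => (f x, g x)) ⁻¹' {(a, b)})).toReal with hr
  have hrp : ∀ a, ∑ b, r a b = p a := by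
    intro a
    rw [hr, hp]
    simp only
    rw [← ENNReal.toReal_sum (fun a _ => measure_ne_top _ _)]
    have : ∀ b, (fun x => (f x, g x)) ⁻¹' {(a, b)} = (f ⁻¹' {a}) ∩ g ⁻¹' {b} := by
      intro b; ext x; simp
    simp_rw [this]
    have h2 := sum_measure_preimage_singleton (μ := μ.restrict (f ⁻¹' {a})) (f := g)
      Finset.univ (fun b _ => hg (measurableSet_singleton b))
    simp only [Finset.coe_univ, preimage_univ, Measure.restrict_apply_univ] at h2
    rw [← h2]
    congr 1
    refine Finset.sum_congr rfl fun b _ => ?_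
    rw [Measure.restrict_apply (hg (measurableSet_singleton b)), inter_comm]
  have hrq : ∀ b, ∑ a, r a b = q b := by
    intro b
    rw [hr, hq]
    simp only
    rw [← ENNReal.toReal_sum (fun a _ => measure_ne_top _ _)]
    have : ∀ a, (fun x => (f x, g x)) ⁻¹' {(a, b)} = (g ⁻¹' {b}) ∩ f ⁻¹' {a} := by
      intro a; ext x; simp [and_comm]
    simp_rw [this]
    have h2 := sum_measure_preimage_singleton (μ := μ.restrict (g ⁻¹' {b})) (f := f)
      Finset.univ (fun b _ => hf (measurableSet_singleton b))
    simp only [Finset.coe_univ, preimage_univ, Measure.restrict_apply_univ] at h2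
    rw [← h2]
    congr 1
    refine Finset.sum_congr rfl fun a _ => ?_
    rw [Measure.restrict_apply (hf (measurableSet_singleton a)), inter_comm]
  have hr0 : ∀ a b, 0 ≤ r a b := fun _ _ => ENNReal.toReal_nonneg
  have hp0 : ∀ a, 0 ≤ p a := fun _ => ENNReal.toReal_nonneg
  have hq0 : ∀ b, 0 ≤ q b := fun _ => ENNReal.toReal_nonneg
  have hle_p : ∀ a b, r a b ≤ p a := fun a b => by
    rw [← hrp]; exact Finset.single_le_sum (fun b _ => hr0 a b) (Finset.mem_univ b)
  have hle_q : ∀ a b, r a b ≤ q b := fun a b => by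
    rw [← hrq]; exact Finset.single_le_sum (f := fun a => r a b) (fun a _ => hr0 a b)
      (Finset.mem_univ a)
  have hterm : ∀ a b, Real.negMulLog (r a b) ≤
      (p a * q b - r a b) - r a b * Real.log (p a) - r a b * Real.log (q b) := by
    intro a b
    rcases (hr0 a b).eq_or_lt with h0 | h0
    · rw [← h0]; simpa using mul_nonneg (hp0 a) (hq0 b)
    have h1 := h0.trans_le (hle_p a b)
    have h2 := h0.trans_le (hle_q a b)
    have := negMulLog_le_sub_sub_mul_log (hr0 a b) (mul_nonneg (hp0 a) (hq0 b))
      fun h => absurd h (by positivity)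
    rw [Real.log_mul h1.ne' h2.ne'] at this
    linarith
  have hsum : infoEntropy μ (fun x => (f x, g x)) = ∑ a, ∑ b, Real.negMulLog (r a b) := by
    rw [infoEntropy, Fintype.sum_prod_type]
  have e1 : ∑ a, ∑ b, r a b * Real.log (p a) = ∑ a, p a * Real.log (p a) :=
    Finset.sum_congr rfl fun a _ => by rw [← Finset.sum_mul, hrp]
  have e2 : ∑ a, ∑ b, r a b * Real.log (q b) = ∑ b, q b * Real.log (q b) := by
    rw [Finset.sum_comm]
    exact Finset.sum_congr rfl fun a _ => by rw [← Finset.sum_mul, hrq]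
  have e3 : ∑ a, ∑ b, (p a * q b - r a b) = 0 := by
    simp_rw [Finset.sum_sub_distrib, hrp, ← Finset.mul_sum]
    rw [sum_measure_preimage_singleton_toReal hg]
    simp
  have e4 : infoEntropy μ f = - ∑ a, p a * Real.log (p a) := by
    simp [infoEntropy, Real.negMulLog, hp]
  have e5 : infoEntropy μ g = - ∑ a, q a * Real.log (q a) := by
    simp [infoEntropy, Real.negMulLog, hq]
  rw [hsum, e4, e5]
  refine (Finset.sum_le_sum fun a _ => Finset.sum_le_sum fun b _ => hterm a b).trans ?_
  simp_rw [Finset.sum_sub_distrib] at e3 ⊢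
  rw [e1, e2, e3]
  linarith

theorem infoEntropy_pi_le [IsProbabilityMeasure μ]
    [MeasurableSpace α] [MeasurableSingletonClass α] (n : ℕ) {f : Fin n → Ω → α}
    (hf : ∀ i, Measurable (f i)) :
    infoEntropy μ (fun x i => f i x) ≤ ∑ i, infoEntropy μ (f i) := by
  induction n with
  | zero =>
    simp only [Finset.univ_eq_empty, Finset.sum_empty]
    have := infoEntropy_le_log_card (μ := μ) (f := fun x (i : Fin 0) => f i x)
      (measurable_pi_lambda _ fun i => i.elim0)
    simpa using this
  | succ n ih =>
    rw [Fin.sum_univ_succ]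
    have h1 : Measurable fun x (i : Fin n) => f i.succ x :=
      measurable_pi_lambda _ fun i => hf _
    refine le_trans ?_ (add_le_add_right (ih fun i => hf i.succ) _)
    refine le_trans ?_ (infoEntropy_prodMk_le (hf 0) h1)
    refine infoEntropy_le_of_ae_eq_comp ((hf 0).prodMk h1)
      (fun p => (Fin.cons p.1 p.2 : Fin (n + 1) → α)) (ae_of_all _ fun x => ?_)
    funext i
    refine Fin.cases ?_ (fun i => ?_) i <;> simp

theorem infoEntropy_prodMk_of_uniform [IsProbabilityMeasure μ] [Nonempty α]
    [MeasurableSpace β] [MeasurableSingletonClass β] {f : Ω → α}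
    {g : Ω → β} (hg : Measurable g)
    (h : ∀ a b, μ (f ⁻¹' {a} ∩ g ⁻¹' {b}) = (Fintype.card α : ℝ≥0∞)⁻¹ * μ (g ⁻¹' {b})) :
    infoEntropy μ (fun x => (f x, g x)) = Real.log (Fintype.card α) + infoEntropy μ g := by
  have hc : (0 : ℝ) < Fintype.card α := by exact_mod_cast Fintype.card_pos
  have h1 : ∀ a b, (μ ((fun x => (f x, g x)) ⁻¹' {(a, b)})).toReal
      = (Fintype.card α : ℝ)⁻¹ * (μ (g ⁻¹' {b})).toReal := by
    intro a b
    have : (fun x => (f x, g x)) ⁻¹' {(a, b)} = f ⁻¹' {a} ∩ g ⁻¹' {b} := by ext; simp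
    rw [this, h, ENNReal.toReal_mul, ENNReal.toReal_inv, ENNReal.toReal_natCast]
  simp only [infoEntropy, Fintype.sum_prod_type, h1, Real.negMulLog_mul]
  simp_rw [Finset.sum_add_distrib, ← Finset.sum_mul, ← Finset.mul_sum]
  rw [sum_measure_preimage_singleton_toReal hg]
  simp only [Real.negMulLog, Real.log_inv, Finset.sum_const, Finset.card_univ, nsmul_eq_mul]
  field_simp

end Entropy

theorem measurable_itinerary {X α : Type*} [MeasurableSpace X] [MeasurableSpace α] {T : X → X}
    (hT : Measurable T) {P : X → α} (hP : Measurable P) (n : ℕ) :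
    Measurable fun x => fun i : Fin n => P (T^[(i : ℕ)] x) :=
  measurable_pi_lambda _ fun _ => hP.comp (hT.iterate _)

section EntropyRate

variable {X : Type*} [MeasurableSpace X] {μ : Measure X} [IsProbabilityMeasure μ] {T : X → X}
variable {α : Type*} [Fintype α] [MeasurableSpace α] [MeasurableSingletonClass α]

theorem subadditive_infoEntropy_itinerary (hT : MeasurePreserving T μ μ) {P : X → α}
    (hP : Measurable P) :
    Subadditive fun n : ℕ => infoEntropy μ (fun x => fun i : Fin n => P (T^[(i : ℕ)] x)) := by
  intro m n
  have hm := measurable_itinerary hT.measurable hP m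
  have hn := measurable_itinerary hT.measurable hP n
  beta_reduce
  rw [← infoEntropy_comp_measurePreserving (hT.iterate m) hn]
  refine le_trans ?_ (infoEntropy_prodMk_le hm (hn.comp (hT.measurable.iterate m)))
  refine infoEntropy_le_of_ae_eq_comp (hm.prodMk (hn.comp (hT.measurable.iterate m)))
    (fun p => Fin.append p.1 p.2) (ae_of_all _ fun x => ?_)
  funext i
  refine Fin.addCases (fun i => ?_) (fun i => ?_) i
  · simp
  · simp [← Function.iterate_add_apply, add_comm]

theorem tendsto_infoEntropy_itinerary_div (hT : MeasurePreserving T μ μ) {P : X → α}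
    (hP : Measurable P) :
    Tendsto (fun n : ℕ => infoEntropy μ (fun x => fun i : Fin n => P (T^[(i : ℕ)] x)) / n) atTop
      (nhds (entropyWrt μ T P)) := by
  have h := (subadditive_infoEntropy_itinerary hT hP).tendsto_lim
    ⟨0, by rintro _ ⟨n, rfl⟩; exact div_nonneg (infoEntropy_nonneg _) n.cast_nonneg⟩
  rwa [entropyWrt, h.liminf_eq]

theorem entropyWrt_nonneg (hT : MeasurePreserving T μ μ) {P : X → α} (hP : Measurable P) :
    0 ≤ entropyWrt μ T P :=
  ge_of_tendsto (tendsto_infoEntropy_itinerary_div hT hP)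
    (Eventually.of_forall fun n => div_nonneg (infoEntropy_nonneg _) n.cast_nonneg)

theorem entropyWrt_equiv_comp_le (hT : MeasurePreserving T μ μ) {β : Type*} [Fintype β]
    [MeasurableSpace β] [MeasurableSingletonClass β]
    {P : X → α} (hP : Measurable P) (e : α → β) (he : Function.Injective e) (h : Measurable e) :
    entropyWrt μ T P ≤ entropyWrt μ T (e ∘ P) := by
  classical
  refine le_of_tendsto_of_tendsto' (tendsto_infoEntropy_itinerary_div hT hP)
    (tendsto_infoEntropy_itinerary_div hT (h.comp hP)) fun n => ?_
  gcongr
  rcases isEmpty_or_nonempty α with hα | hα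
  · have : IsEmpty X := ⟨fun x => hα.elim (P x)⟩
    exact absurd (μ.eq_zero_of_isEmpty) (IsProbabilityMeasure.ne_zero μ)
  refine infoEntropy_le_of_ae_eq_comp (measurable_itinerary hT.measurable (h.comp hP) n)
    (fun v i => Function.invFun e (v i)) (ae_of_all _ fun x => ?_)
  funext i
  exact (Function.leftInverse_invFun he _).symm

theorem ofReal_entropyWrt_le_ksEntropy (hT : MeasurePreserving T μ μ) {P : X → α}
    (hP : Measurable P) : ENNReal.ofReal (entropyWrt μ T P) ≤ ksEntropy μ T := by
  have he : Measurable (Fintype.equivFin α) := measurable_of_countable _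
  refine (ENNReal.ofReal_le_ofReal
    (entropyWrt_equiv_comp_le hT hP (Fintype.equivFin α) (Equiv.injective _) he)).trans ?_
  exact le_iSup_of_le _ (le_iSup₂_of_le (Fintype.equivFin α ∘ P) (he.comp hP) le_rfl)

theorem exists_entropyWrt_gt (hT : MeasurePreserving T μ μ) (hfin : ksEntropy μ T ≠ ⊤) {κ : ℝ}
    (hκ : 0 < κ) : ∃ (k : ℕ) (P : X → Fin k), Measurable P ∧
      (ksEntropy μ T).toReal - κ < entropyWrt μ T P := by
  by_cases h0 : (ksEntropy μ T).toReal - κ < 0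
  · refine ⟨1, fun _ => 0, measurable_const, h0.trans_le (entropyWrt_nonneg hT measurable_const)⟩
  have h1 : ENNReal.ofReal ((ksEntropy μ T).toReal - κ) < ksEntropy μ T := by
    rw [ENNReal.ofReal_lt_iff_lt_toReal (not_lt.1 h0) hfin]
    linarith
  conv_rhs at h1 => rw [ksEntropy]
  obtain ⟨k, h1⟩ := lt_iSup_iff.1 h1
  obtain ⟨P, h1⟩ := lt_iSup_iff.1 h1
  obtain ⟨hP, h1⟩ := lt_iSup_iff.1 h1
  refine ⟨k, P, hP, ?_⟩
  exact (ENNReal.ofReal_lt_ofReal_iff_of_nonneg (not_lt.1 h0)).1 h1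

theorem entropyWrt_le_toReal_ksEntropy (hT : MeasurePreserving T μ μ) (hfin : ksEntropy μ T ≠ ⊤)
    {P : X → α} (hP : Measurable P) : entropyWrt μ T P ≤ (ksEntropy μ T).toReal :=
  (ENNReal.ofReal_le_iff_le_toReal hfin).1 (ofReal_entropyWrt_le_ksEntropy hT hP)

end EntropyRate

section Lift

variable {Z D : Type*} [TopologicalSpace Z] [T2Space Z] [CompactSpace Z]
  [SecondCountableTopology Z] [MeasurableSpace Z] [BorelSpace Z]
  [TopologicalSpace D] [T2Space D] [CompactSpace D]
  [SecondCountableTopology D] [MeasurableSpace D] [BorelSpace D]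

/-- The invariant probability measures that are carried by `F` and project to `P`. -/
def invariantLifts (G : Z → Z) (p : Z → D) (P : Measure D) (F : Set Z) :
    Set (ProbabilityMeasure Z) :=
  {Ξ | MeasurePreserving G (Ξ : Measure Z) Ξ ∧ (Ξ : Measure Z).map p = P ∧ (Ξ : Measure Z) F = 1}

lemma isClosed_setOf_map_eq {Z' : Type*} [TopologicalSpace Z'] [MeasurableSpace Z'] [BorelSpace Z']
    {p : Z' → D} (hp : Continuous p) (P : Measure D) [IsProbabilityMeasure P] :
    IsClosed {Ξ : ProbabilityMeasure Z' | (Ξ : Measure Z').map p = P} := by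
  have : {Ξ : ProbabilityMeasure Z' | (Ξ : Measure Z').map p = P}
      = (fun Ξ : ProbabilityMeasure Z' => Ξ.map hp.measurable.aemeasurable) ⁻¹'
        {⟨P, inferInstance⟩} := by
    ext Ξ
    exact ⟨fun h => Subtype.ext h, fun h => congrArg Subtype.val h⟩
  rw [this]
  exact isClosed_singleton.preimage (ProbabilityMeasure.continuous_map hp)

lemma isClosed_setOf_measure_eq_one {F : Set Z} (hF : IsClosed F) :
    IsClosed {Ξ : ProbabilityMeasure Z | (Ξ : Measure Z) F = 1} := by
  rw [isClosed_iff_ultrafilter]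
  intro Ξ u hu hmem
  have h := ProbabilityMeasure.limsup_measure_closed_le_of_tendsto
    (L := (u : Filter (ProbabilityMeasure Z))) (μs := id) hu hF
  rw [limsup_congr (v := fun _ => 1) (by filter_upwards [hmem] with Ξ' h using h), limsup_const] at h
  exact le_antisymm prob_le_one h

lemma isClosed_setOf_measurePreserving {G : Z → Z} (hG : Continuous G) :
    IsClosed {Ξ : ProbabilityMeasure Z | MeasurePreserving G (Ξ : Measure Z) Ξ} := by
  have : {Ξ : ProbabilityMeasure Z | MeasurePreserving G (Ξ : Measure Z) Ξ}
      = {Ξ : ProbabilityMeasure Z | Ξ.map hG.measurable.aemeasurable = Ξ} := by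
    ext Ξ
    exact ⟨fun h => Subtype.ext h.map_eq, fun h => ⟨hG.measurable, congrArg Subtype.val h⟩⟩
  rw [this]
  exact isClosed_eq (ProbabilityMeasure.continuous_map hG) continuous_id

lemma isCompact_invariantLifts {G : Z → Z} (hG : Continuous G) {p : Z → D} (hp : Continuous p)
    (P : Measure D) [IsProbabilityMeasure P] {F : Set Z} (hF : IsClosed F) :
    IsCompact (invariantLifts G p P F) :=
  ((isClosed_setOf_measurePreserving hG).inter
    ((isClosed_setOf_map_eq hp P).inter (isClosed_setOf_measure_eq_one hF))).isCompact

lemma cond_mem_invariantLifts {G : Z → Z} {p : Z → D} (hp : Measurable p)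
    {τ : D → D} (hcomm : Function.Semiconj p G τ) {P : Measure D} [IsProbabilityMeasure P]
    (hP : Ergodic τ P) {F : Set Z} (hF : IsClosed F) {Ξ : ProbabilityMeasure Z}
    (hΞ : Ξ ∈ invariantLifts G p P F)
    {A : Set Z} (hA : MeasurableSet A) (hAG : G ⁻¹' A = A) (hA0 : (Ξ : Measure Z) A ≠ 0) :
    (⟨ProbabilityTheory.cond (Ξ : Measure Z) A, ProbabilityTheory.cond_isProbabilityMeasure hA0⟩ :
      ProbabilityMeasure Z) ∈ invariantLifts G p P F := by
  obtain ⟨h1, h2, h3⟩ := hΞ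
  have := ProbabilityTheory.cond_isProbabilityMeasure hA0
  have hac : ProbabilityTheory.cond (Ξ : Measure Z) A ≪ (Ξ : Measure Z) :=
    ProbabilityTheory.cond_absolutelyContinuous
  have hinv : MeasurePreserving G (ProbabilityTheory.cond (Ξ : Measure Z) A)
      (ProbabilityTheory.cond (Ξ : Measure Z) A) := by
    have := h1.restrict_preimage hA
    rw [hAG] at this
    exact this.smul_measure _
  refine ⟨hinv, ?_, ?_⟩
  · show Measure.map p (ProbabilityTheory.cond (Ξ : Measure Z) A) = P
    have : IsProbabilityMeasure (Measure.map p (ProbabilityTheory.cond (Ξ : Measure Z) A)) :=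
      Measure.isProbabilityMeasure_map hp.aemeasurable
    refine hP.eq_of_absolutelyContinuous ?_ ?_
    · exact MeasurePreserving.of_semiconj ⟨hp, rfl⟩ hinv hcomm hP.measurable
    · rw [← h2]; exact hac.map hp
  · show ProbabilityTheory.cond (Ξ : Measure Z) A F = 1
    rw [← prob_compl_eq_zero_iff hF.measurableSet] at h3 ⊢
    exact hac h3

lemma exists_ergodic_of_invariantLifts_nonempty {G : Z → Z} (hG : Continuous G) {p : Z → D}
    (hp : Continuous p) {τ : D → D} (hcomm : Function.Semiconj p G τ) {P : Measure D}
    [IsProbabilityMeasure P] (hP : Ergodic τ P) {F : Set Z} (hF : IsClosed F)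
    (hne : (invariantLifts G p P F).Nonempty) :
    ∃ Ξ ∈ invariantLifts G p P F, Ergodic G (Ξ : Measure Z) := by
  let Φ : ProbabilityMeasure Z → ((Z →ᵇ ℝ) → ℝ) := fun Ξ f => ∫ x, f x ∂(Ξ : Measure Z)
  have hΦ : Continuous Φ := by
    refine continuous_pi fun f => ?_
    exact ProbabilityMeasure.continuous_integral_boundedContinuousFunction f
  have hΦinj : ∀ Ξ Ξ' : ProbabilityMeasure Z, Φ Ξ = Φ Ξ' → Ξ = Ξ' := fun Ξ Ξ' h =>
    Subtype.ext (ext_of_forall_integral_eq_of_IsFiniteMeasure (μ := (Ξ : Measure Z))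
      (ν := (Ξ' : Measure Z)) fun f => congrFun h f)
  obtain ⟨e, he⟩ := ((isCompact_invariantLifts hG hp P hF).image hΦ).extremePoints_nonempty
    (hne.image Φ)
  rw [mem_extremePoints] at he
  obtain ⟨⟨Ξ, hΞ, rfl⟩, hext⟩ := he
  refine ⟨Ξ, hΞ, hΞ.1, ⟨fun A hA hAG => ?_⟩⟩
  rw [eventuallyConst_set']
  by_contra hcon
  push Not at hcon
  obtain ⟨hA0, hA1⟩ := hcon
  have hA0' : (Ξ : Measure Z) A ≠ 0 := fun h => hA0 (ae_eq_empty.2 h)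
  have hA1' : (Ξ : Measure Z) Aᶜ ≠ 0 := fun h => hA1 (ae_eq_univ.2 h)
  have hm1 := cond_mem_invariantLifts hp.measurable hcomm hP hF hΞ hA hAG hA0'
  have hm2 := cond_mem_invariantLifts hp.measurable hcomm hP hF hΞ hA.compl
    (by rw [preimage_compl, hAG]) hA1'
  have hsum : ((Ξ : Measure Z) A).toReal + ((Ξ : Measure Z) Aᶜ).toReal = 1 := by
    rw [← ENNReal.toReal_add (by simp) (by simp), prob_add_prob_compl hA]; simp
  have := hext _ ⟨_, hm1, rfl⟩ _ ⟨_, hm2, rfl⟩ ⟨((Ξ : Measure Z) A).toReal,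
    ((Ξ : Measure Z) Aᶜ).toReal, ENNReal.toReal_pos hA0' (by simp),
    ENNReal.toReal_pos hA1' (by simp), hsum, ?_⟩
  · have h2 := hΦinj _ _ this.1
    have h3 : ProbabilityTheory.cond (Ξ : Measure Z) A Aᶜ = (Ξ : Measure Z) Aᶜ := by
      conv_rhs => rw [← h2]
      rfl
    rw [ProbabilityTheory.cond_apply hA] at h3
    simp at h3
    exact hA1' h3.symm
  · ext f
    simp only [Pi.add_apply, Pi.smul_apply, smul_eq_mul, Φ, ProbabilityTheory.cond]
    show _ * ∫ x, f x ∂(((Ξ : Measure Z) A)⁻¹ • (Ξ : Measure Z).restrict A)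
      + _ * ∫ x, f x ∂(((Ξ : Measure Z) Aᶜ)⁻¹ • (Ξ : Measure Z).restrict Aᶜ) = _
    rw [integral_smul_measure, integral_smul_measure, ENNReal.toReal_inv, ENNReal.toReal_inv,
      smul_eq_mul, smul_eq_mul, mul_inv_cancel_left₀ (ENNReal.toReal_pos hA0' (by simp)).ne',
      mul_inv_cancel_left₀ (ENNReal.toReal_pos hA1' (by simp)).ne']
    exact integral_add_compl hA (f.integrable _)

end Lift

section Birkhoff

variable {Z : Type*} [MeasurableSpace Z]

/-- The average of the first `n + 1` push-forwards of a measure. -/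
noncomputable def pushforwardAverage (G : Z → Z) (Θ : Measure Z) (n : ℕ) : Measure Z :=
  ((n + 1 : ℕ) : ℝ≥0∞)⁻¹ • ∑ i ∈ Finset.range (n + 1), Θ.map G^[i]

lemma pushforwardAverage_apply_eq {G : Z → Z} (hG : Measurable G) {Θ : Measure Z} {n : ℕ}
    {A : Set Z} (hA : MeasurableSet A) {c : ℝ≥0∞}
    (h : ∀ i < n + 1, Θ (G^[i] ⁻¹' A) = c) : pushforwardAverage G Θ n A = c := by
  rw [pushforwardAverage, Measure.smul_apply, Measure.finsetSum_apply, smul_eq_mul,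
    Finset.sum_congr rfl (g := fun _ => c), Finset.sum_const, Finset.card_range, nsmul_eq_mul,
    ← mul_assoc, ENNReal.inv_mul_cancel (by simp) (by simp), one_mul]
  intro i hi
  rw [Measure.map_apply (hG.iterate i) hA, h i (Finset.mem_range.1 hi)]

lemma integral_comp_sub_integral_pushforwardAverage [TopologicalSpace Z] [OpensMeasurableSpace Z]
    {G : Z → Z} (hG : Continuous G) (hGm : Measurable G)
    (Θ : Measure Z) [IsProbabilityMeasure Θ] (n : ℕ) (f : Z →ᵇ ℝ) :
    |∫ x, f (G x) ∂(pushforwardAverage G Θ n) - ∫ x, f x ∂(pushforwardAverage G Θ n)|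
      ≤ 2 * ‖f‖ / ((n : ℝ) + 1) := by
  have key : ∀ g : Z →ᵇ ℝ, ∫ x, g x ∂(pushforwardAverage G Θ n)
      = ((n : ℝ) + 1)⁻¹ * ∑ i ∈ Finset.range (n + 1), ∫ x, g (G^[i] x) ∂Θ := by
    intro g
    have hp : ∀ i, IsProbabilityMeasure (Θ.map G^[i]) := fun i =>
      Measure.isProbabilityMeasure_map (hGm.iterate i).aemeasurable
    rw [pushforwardAverage, integral_smul_measure, integral_finsetSum_measure
      (fun i _ => g.integrable _), smul_eq_mul]
    congr 1
    · rw [ENNReal.toReal_inv, ENNReal.toReal_natCast, Nat.cast_add_one]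
    · refine Finset.sum_congr rfl fun i _ => ?_
      rw [integral_map (hGm.iterate i).aemeasurable]
      exact g.continuous.measurable.aestronglyMeasurable
  have h1 := key (f.compContinuous ⟨G, hG⟩)
  simp only [BoundedContinuousFunction.compContinuous_apply, ContinuousMap.coe_mk,
    ← Function.iterate_succ_apply' G] at h1
  have hb : ∀ i, |∫ x, f (G^[i] x) ∂Θ| ≤ ‖f‖ := fun i => by
    have := norm_integral_le_of_norm_le_const (μ := Θ) (f := fun x => f (G^[i] x)) (C := ‖f‖)
      (ae_of_all _ fun x => f.norm_coe_le_norm _)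
    simpa using this
  rw [h1, key f, ← mul_sub, ← Finset.sum_sub_distrib,
    Finset.sum_range_sub (fun i => ∫ x, f (G^[i] x) ∂Θ), abs_mul, abs_of_nonneg (by positivity),
    div_eq_inv_mul]
  gcongr
  calc _ ≤ |∫ x, f (G^[n + 1] x) ∂Θ| + |∫ x, f (G^[0] x) ∂Θ| := abs_sub _ _
    _ ≤ 2 * ‖f‖ := by linarith [hb (n + 1), hb 0]

end Birkhoff

section Lift

variable {Z D : Type*} [TopologicalSpace Z] [T2Space Z] [CompactSpace Z]
  [SecondCountableTopology Z] [MeasurableSpace Z] [BorelSpace Z]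
  [TopologicalSpace D] [T2Space D] [CompactSpace D]
  [SecondCountableTopology D] [MeasurableSpace D] [BorelSpace D]

lemma invariantLifts_nonempty {G : Z → Z} (hG : Continuous G) {p : Z → D}
    (hp : Continuous p) {τ : D → D} (hcomm : Function.Semiconj p G τ) {P : Measure D}
    [IsProbabilityMeasure P] (hP : MeasurePreserving τ P P) {F : Set Z} (hF : IsClosed F)
    (hne : ∀ n : ℕ, ∃ Θ : Measure Z, Θ.map p = P ∧ ∀ i < n, Θ (G^[i] ⁻¹' F)ᶜ = 0) :
    (invariantLifts G p P F).Nonempty := by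
  choose Θ hΘp hΘF using hne
  have hΘ : ∀ n, IsProbabilityMeasure (Θ n) := fun n => ⟨by
    have := congrArg (fun ν => ν univ) (hΘp n)
    simpa [Measure.map_apply hp.measurable MeasurableSet.univ] using this⟩
  have hprob : ∀ n, IsProbabilityMeasure (pushforwardAverage G (Θ (n + 1)) n) := fun n =>
    ⟨pushforwardAverage_apply_eq hG.measurable MeasurableSet.univ (by simp)⟩
  let A : ℕ → ProbabilityMeasure Z := fun n => ⟨pushforwardAverage G (Θ (n + 1)) n, hprob n⟩
  have hAp : ∀ n, (A n : Measure Z).map p = P := by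
    intro n
    ext B hB
    rw [Measure.map_apply hp.measurable hB]
    refine pushforwardAverage_apply_eq hG.measurable (hp.measurable hB) fun i _ => ?_
    rw [← preimage_comp, (hcomm.iterate_right i).comp_eq, preimage_comp,
      ← Measure.map_apply hp.measurable ((hP.measurable.iterate i) hB), hΘp,
      (hP.iterate i).measure_preimage hB.nullMeasurableSet]
  have hAF : ∀ n, (A n : Measure Z) F = 1 := by
    intro n
    refine pushforwardAverage_apply_eq hG.measurable hF.measurableSet fun i hi => ?_
    rw [← prob_compl_eq_zero_iff ((hG.measurable.iterate i) hF.measurableSet)]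
    exact hΘF _ i hi
  obtain ⟨Ξ, -, hΞ⟩ := (isCompact_univ (X := ProbabilityMeasure Z)).ultrafilter_le_nhds
    ((hyperfilter ℕ).map A) (by simp)
  have hlim : Tendsto A (hyperfilter ℕ) (nhds Ξ) := hΞ
  refine ⟨Ξ, ⟨hG.measurable, ?_⟩, ?_, ?_⟩
  · have := Measure.isProbabilityMeasure_map (μ := (Ξ : Measure Z)) hG.measurable.aemeasurable
    refine ext_of_forall_integral_eq_of_IsFiniteMeasure fun f => ?_
    rw [integral_map hG.measurable.aemeasurable f.continuous.measurable.aestronglyMeasurable]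
    have h1 := (ProbabilityMeasure.tendsto_iff_forall_integral_tendsto.1 hlim) f
    have h2 := (ProbabilityMeasure.tendsto_iff_forall_integral_tendsto.1 hlim)
      (f.compContinuous ⟨G, hG⟩)
    have h3 := (h2.sub h1)
    have h4 : Tendsto (fun n : ℕ => 2 * ‖f‖ / ((n : ℝ) + 1)) (hyperfilter ℕ) (nhds 0) :=
      (tendsto_const_div_atTop_nhds_zero_nat (2 * ‖f‖) |>.comp (tendsto_add_atTop_nat 1)
        |>.congr (by intro n; simp)).mono_left Nat.hyperfilter_le_atTop
    have h5 := squeeze_zero_norm (fun n => (Real.norm_eq_abs _).trans_le <|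
      integral_comp_sub_integral_pushforwardAverage hG hG.measurable (Θ (n + 1)) n f) h4
    exact sub_eq_zero.1 (tendsto_nhds_unique h3 h5)
  · exact (isClosed_setOf_map_eq hp P).mem_of_tendsto hlim (Eventually.of_forall hAp)
  · exact (isClosed_setOf_measure_eq_one hF).mem_of_tendsto hlim (Eventually.of_forall hAF)

/-- An ergodic measure on a factor lifts to an ergodic measure carried by a closed set `F`, provided
it lifts, for every `n`, to a measure for which the first `n` iterates stay in `F`. -/
theorem exists_ergodic_lift {G : Z → Z} (hG : Continuous G) {p : Z → D}
    (hp : Continuous p) {τ : D → D} (hcomm : Function.Semiconj p G τ) {P : Measure D}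
    [IsProbabilityMeasure P] (hP : Ergodic τ P) {F : Set Z} (hF : IsClosed F)
    (hne : ∀ n : ℕ, ∃ Θ : Measure Z, Θ.map p = P ∧ ∀ i < n, Θ (G^[i] ⁻¹' F)ᶜ = 0) :
    ∃ Ξ : Measure Z, IsProbabilityMeasure Ξ ∧ Ergodic G Ξ ∧ Ξ.map p = P ∧ ∀ᵐ x ∂Ξ, x ∈ F := by
  obtain ⟨Ξ, hΞ, herg⟩ := exists_ergodic_of_invariantLifts_nonempty hG hp hcomm hP hF
    (invariantLifts_nonempty hG hp hcomm hP.toMeasurePreserving hF hne)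
  exact ⟨Ξ, inferInstance, herg, hΞ.2.1, (mem_ae_iff_prob_eq_one hF.measurableSet).2 hΞ.2.2⟩

end Lift

section Bernoulli

/-- The one-sided shift. -/
def leftShift {E : Type*} (ω : ℕ → E) : ℕ → E := fun n => ω (n + 1)

lemma leftShift_iterate_apply {E : Type*} (n : ℕ) (ω : ℕ → E) (i : ℕ) :
    leftShift^[n] ω i = ω (i + n) := by
  induction n generalizing i with
  | zero => rfl
  | succ n ih => rw [Function.iterate_succ_apply', leftShift, ih, Nat.add_right_comm, add_assoc]

lemma continuous_leftShift {E : Type*} [TopologicalSpace E] :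
    Continuous (leftShift : (ℕ → E) → ℕ → E) :=
  continuous_pi fun n => continuous_apply (n + 1)

variable {E : Type*} [MeasurableSpace E]

lemma measurable_leftShift : Measurable (leftShift : (ℕ → E) → ℕ → E) :=
  measurable_pi_lambda _ fun n => measurable_pi_apply (n + 1)

lemma infinitePi_inter_preimage_leftShift_pi (u : Measure E) [IsProbabilityMeasure u] (n : ℕ)
    {s : Finset ℕ} (hs : ∀ i ∈ s, i < n) {a : ℕ → Set E} (ha : ∀ i, MeasurableSet (a i))
    (s' : Finset ℕ) {t : ℕ → Set E} (ht : ∀ i, MeasurableSet (t i)) :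
    Measure.infinitePi (fun _ : ℕ => u) (Set.pi s a ∩ leftShift^[n] ⁻¹' (Set.pi s' t))
      = (∏ i ∈ s, u (a i)) * ∏ i ∈ s', u (t i) := by
  have hset : (Set.pi s a ∩ leftShift^[n] ⁻¹' (Set.pi s' t) : Set (ℕ → E))
      = Set.pi ((s ∪ s'.map (addRightEmbedding n) : Finset ℕ) : Set ℕ)
        (fun i => if i < n then a i else t (i - n)) := by
    ext ω
    simp only [mem_inter_iff, Set.mem_pi, mem_preimage, leftShift_iterate_apply, Finset.mem_coe,
      Finset.mem_union, Finset.mem_map, addRightEmbedding_apply]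
    constructor
    · rintro ⟨h1, h2⟩ i (hi | ⟨j, hj, rfl⟩)
      · rw [if_pos (hs i hi)]; exact h1 i hi
      · rw [if_neg (by omega), Nat.add_sub_cancel]; exact h2 j hj
    · intro h
      refine ⟨fun i hi => ?_, fun j hj => ?_⟩
      · have := h i (Or.inl hi)
        rwa [if_pos (hs i hi)] at this
      · have := h (j + n) (Or.inr ⟨j, hj, rfl⟩)
        rwa [if_neg (by omega), Nat.add_sub_cancel] at this
  rw [hset, Measure.infinitePi_pi, Finset.prod_union, Finset.prod_map]
  · congr 1
    · exact Finset.prod_congr rfl fun i hi => by rw [if_pos (hs i hi)]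
    · refine Finset.prod_congr rfl fun i _ => ?_
      rw [addRightEmbedding_apply, if_neg (by omega), Nat.add_sub_cancel]
  · rw [Finset.disjoint_left]
    intro i hi hi'
    obtain ⟨j, -, rfl⟩ := Finset.mem_map.1 hi'
    have := hs _ hi
    rw [addRightEmbedding_apply] at this
    omega
  · intro i _
    split_ifs
    exacts [ha i, ht _]

lemma infinitePi_inter_preimage_leftShift (u : Measure E) [IsProbabilityMeasure u] (n : ℕ)
    {s : Finset ℕ} (hs : ∀ i ∈ s, i < n) {a : ℕ → Set E} (ha : ∀ i, MeasurableSet (a i))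
    {B : Set (ℕ → E)} (hB : MeasurableSet B) :
    Measure.infinitePi (fun _ : ℕ => u) (Set.pi s a ∩ leftShift^[n] ⁻¹' B)
      = (∏ i ∈ s, u (a i)) * Measure.infinitePi (fun _ : ℕ => u) B := by
  set β := Measure.infinitePi (fun _ : ℕ => u)
  have hcyl : MeasurableSet (Set.pi (s : Set ℕ) a) :=
    MeasurableSet.pi s.countable_toSet fun i _ => ha i
  have hcm : β (Set.pi s a) = ∏ i ∈ s, u (a i) := Measure.infinitePi_pi _ fun i _ => ha i
  by_cases h0 : β (Set.pi s a) = 0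
  · rw [← hcm, h0, zero_mul]
    exact measure_mono_null inter_subset_left h0
  have hm : Measurable (leftShift^[n] : (ℕ → E) → ℕ → E) := measurable_leftShift.iterate n
  have key : (ProbabilityTheory.cond β (Set.pi s a)).map leftShift^[n] = β := by
    refine Measure.eq_infinitePi _ fun s' t ht => ?_
    rw [Measure.map_apply hm (MeasurableSet.pi s'.countable_toSet fun i _ => ht i),
      ProbabilityTheory.cond_apply hcyl, infinitePi_inter_preimage_leftShift_pi u n hs ha s' ht,
      ← hcm, ← mul_assoc, ENNReal.inv_mul_cancel h0 (measure_ne_top _ _), one_mul]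
  conv_rhs => rw [← key, Measure.map_apply hm hB, ProbabilityTheory.cond_apply hcyl, ← hcm,
    ← mul_assoc, ENNReal.mul_inv_cancel h0 (measure_ne_top _ _), one_mul]

lemma measurePreserving_leftShift (u : Measure E) [IsProbabilityMeasure u] :
    MeasurePreserving (leftShift : (ℕ → E) → ℕ → E) (Measure.infinitePi fun _ => u)
      (Measure.infinitePi fun _ => u) := by
  refine ⟨measurable_leftShift, ?_⟩
  ext B hB
  rw [Measure.map_apply measurable_leftShift hB]
  simpa using infinitePi_inter_preimage_leftShift u 1 (s := ∅) (by simp) (a := fun _ => univ)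
    (by simp) hB

/-- The product of an ergodic system and a one-sided Bernoulli shift is ergodic. -/
theorem ergodic_prodMap_leftShift {W : Type*} [MeasurableSpace W] {R : W → W} {l : Measure W}
    [IsProbabilityMeasure l] (hR : Ergodic R l) (u : Measure E) [IsProbabilityMeasure u] :
    Ergodic (Prod.map R (leftShift : (ℕ → E) → ℕ → E))
      (l.prod (Measure.infinitePi fun _ => u)) := by
  set β := Measure.infinitePi (fun _ : ℕ => u) with hβ
  refine ⟨hR.toMeasurePreserving.prod (measurePreserving_leftShift u), ⟨fun A hA hAG => ?_⟩⟩
  have hAn : ∀ n w, Prod.mk w ⁻¹' A = leftShift^[n] ⁻¹' (Prod.mk (R^[n] w) ⁻¹' A) := by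
    intro n w
    have : (Prod.map R (leftShift : (ℕ → E) → ℕ → E))^[n] ⁻¹' A = A := by
      induction n with
      | zero => rfl
      | succ n ih => rw [Function.iterate_succ, preimage_comp, ih, hAG]
    conv_lhs => rw [← this]
    rw [Prod.map_iterate]
    rfl
  have hsec : ∀ w, MeasurableSet (Prod.mk w ⁻¹' A) := fun w => measurable_prodMk_left hA
  have hgm : Measurable fun w => β (Prod.mk w ⁻¹' A) := measurable_measure_prodMk_left hA
  have hginv : ∀ n w, β (Prod.mk (R^[n] w) ⁻¹' A) = β (Prod.mk w ⁻¹' A) := fun n w => by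
    rw [hAn n w, ((measurePreserving_leftShift u).iterate n).measure_preimage
      (hsec _).nullMeasurableSet]
  obtain ⟨c, hc⟩ := hR.toPreErgodic.ae_eq_const_of_ae_eq_comp hgm (funext fun w => hginv 1 w)
  have hrect : ∀ G : Set W, MeasurableSet G → ∀ (s : Finset ℕ) (a : ℕ → Set E),
      (∀ i, MeasurableSet (a i)) →
      (l.prod β).restrict A (G ×ˢ Set.pi s a) = c * l G * β (Set.pi s a) := by
    intro G hG s a ha
    have hcyl : MeasurableSet (Set.pi (s : Set ℕ) a) :=
      MeasurableSet.pi s.countable_toSet fun i _ => ha i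
    set n := s.sup id + 1
    have hs : ∀ i ∈ s, i < n := fun i hi => Nat.lt_succ_of_le (Finset.le_sup (f := id) hi)
    rw [Measure.restrict_apply (hG.prod hcyl), Measure.prod_apply ((hG.prod hcyl).inter hA)]
    have : (fun w => β (Prod.mk w ⁻¹' (G ×ˢ Set.pi s a ∩ A)))
        =ᵐ[l] G.indicator (fun _ => c * β (Set.pi s a)) := by
      filter_upwards [hc] with w hw
      by_cases hwG : w ∈ G
      · rw [indicator_of_mem hwG, preimage_inter, mk_preimage_prod_right hwG, hAn n w,
          infinitePi_inter_preimage_leftShift u n hs ha (hsec _), hginv n w, mul_comm, hw,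
          Measure.infinitePi_pi _ fun i _ => ha i]
        rfl
      · rw [indicator_of_notMem hwG, preimage_inter, mk_preimage_prod_right_eq_empty hwG,
          empty_inter, measure_empty]
    rw [lintegral_congr_ae this, lintegral_indicator hG, setLIntegral_const]
    ring
  have hAc : (l.prod β) A = c := by
    have := hrect univ MeasurableSet.univ ∅ (fun _ => univ) (by simp)
    simpa using this
  have hc1 : c ≤ 1 := hAc ▸ prob_le_one
  have hcfin : IsFiniteMeasure (c • l) := ⟨by
    rw [Measure.smul_apply, measure_univ, smul_eq_mul, mul_one]
    exact hc1.trans_lt ENNReal.one_lt_top⟩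
  have hprod : (c • l).prod β = (l.prod β).restrict A := by
    refine Measure.prod_eq_generateFrom (C := {s | MeasurableSet s})
      (D := squareCylinders fun _ : ℕ => {s : Set E | MeasurableSet s})
      MeasurableSpace.generateFrom_measurableSet generateFrom_squareCylinders
      MeasurableSpace.isPiSystem_measurableSet
      (isPiSystem_squareCylinders (fun _ => MeasurableSpace.isPiSystem_measurableSet) (by simp))
      (Measure.toFiniteSpanningSetsIn _) ?_ ?_
    · exact ⟨fun _ => univ, fun _ => ⟨∅, fun _ => univ, by simp, by simp⟩, by simp,
        iUnion_const _⟩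
    · rintro G hG _ ⟨s, a, ha, rfl⟩
      rw [hrect G hG s a fun i => ha i trivial, Measure.smul_apply, smul_eq_mul]
  have hcc : c * c = c := by
    have := congrArg (fun ν => ν A) hprod
    simp only [Measure.restrict_apply_self, hAc] at this
    rwa [Measure.prod_smul_left, Measure.smul_apply, smul_eq_mul, hAc] at this
  rw [eventuallyConst_set']
  by_cases h0 : c = 0
  · left; rw [ae_eq_empty, hAc, h0]
  · right
    have h1 : c = 1 := by
      have := congrArg (fun t => c⁻¹ * t) hcc
      simpa [← mul_assoc, ENNReal.inv_mul_cancel h0 (hc1.trans_lt ENNReal.one_lt_top).ne] using this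
    rw [ae_eq_univ, prob_compl_eq_zero_iff hA, hAc, h1]

end Bernoulli

/-- A neighbourhood of a law contains the laws of all random points that are close in
probability to a random point with the given law. -/
lemma exists_dist_map_mem {Ω : Type*} [MetricSpace Ω]
    [MeasurableSpace Ω] [BorelSpace Ω] (ξ : ProbabilityMeasure Ω)
    {O : Set (ProbabilityMeasure Ω)} (hO : O ∈ nhds ξ) {W : Type*} [MeasurableSpace W] :
    ∃ ε : ℝ, 0 < ε ∧ ∀ (ζ : ProbabilityMeasure Ω)
      (κ : Measure W) (f g : W → Ω), IsProbabilityMeasure κ → Measurable f → Measurable g →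
      κ.map f = ξ → κ.map g = ζ → κ {x | ε < dist (f x) (g x)} ≤ ENNReal.ofReal ε → ζ ∈ O := by
  have h1 : LevyProkhorov.toMeasure ⁻¹' O ∈ nhds (LevyProkhorov.ofMeasure ξ) :=
    (LevyProkhorov.continuous_toMeasure_probabilityMeasure (Ω := Ω)).continuousAt hO
  obtain ⟨δ, hδ, hball⟩ := Metric.mem_nhds_iff.1 h1
  refine ⟨δ / 2, by positivity, fun ζ κ f g _ hf hg hfξ hgζ hκ => ?_⟩
  have hmem : LevyProkhorov.ofMeasure ζ ∈ Metric.ball (LevyProkhorov.ofMeasure ξ) δ := by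
    rw [Metric.mem_ball, LevyProkhorov.dist_probabilityMeasure_def]
    refine (levyProkhorovDist_le_of_forall_le _ _ (δ := δ / 2) (by positivity) ?_).trans_lt
      (by linarith)
    intro ε B hε hB
    simp only
    rw [← hfξ, ← hgζ, Measure.map_apply hg hB,
      Measure.map_apply hf Metric.isOpen_thickening.measurableSet]
    have hsub : g ⁻¹' B ⊆ f ⁻¹' (Metric.thickening ε B) ∪ {x | δ / 2 < dist (f x) (g x)} := by
      intro x hx
      by_cases h : δ / 2 < dist (f x) (g x)
      · exact Or.inr h
      · exact Or.inl (Metric.mem_thickening_iff.2 ⟨g x, hx, by linarith⟩)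
    calc κ (g ⁻¹' B) ≤ _ := measure_mono hsub
      _ ≤ _ := measure_union_le _ _
      _ ≤ _ := by gcongr; exact hκ.trans (ENNReal.ofReal_le_ofReal hε.le)
  exact hball hmem

/-- Below the topological entropy there are exponentially large separated sets. -/
lemma exists_separated_of_lt_topEntropy {Y : Type*} [MetricSpace Y] {S : Y → Y} {h : ℝ}
    (hh : (h : EReal) < topEntropy S) :
    ∃ h' : ℝ, h < h' ∧ ∃ δ : ℝ, 0 < δ ∧ ∃ᶠ n : ℕ in atTop, ∃ E : Finset Y,
      Real.exp (h' * n) ≤ E.card ∧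
      ∀ u ∈ E, ∀ v ∈ E, u ≠ v → ∃ t < n, δ ≤ dist (S^[t] u) (S^[t] v) := by
  obtain ⟨h₂, hh₂, hh₂'⟩ := EReal.lt_iff_exists_real_btwn.1 hh
  obtain ⟨h₁, hh₁, hh₁'⟩ := exists_between (EReal.coe_lt_coe_iff.1 hh₂)
  rw [topEntropy, Dynamics.coverEntropy_eq_iSup_basis_netEntropyEntourage
    Metric.uniformity_basis_dist, lt_iSup_iff] at hh₂'
  obtain ⟨δ, hδ⟩ := hh₂'
  obtain ⟨hδ0, hδ⟩ := lt_iSup_iff.1 hδ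
  refine ⟨h₁, hh₁, δ, hδ0, ?_⟩
  have hfreq := ExpGrowth.frequently_exp_le hδ
  refine (hfreq.and_eventually (eventually_gt_atTop 0)).mono ?_
  rintro n ⟨hn, hn0⟩
  by_contra hcon
  push Not at hcon
  have hle : Dynamics.netMaxcard S univ {p : Y × Y | dist p.1 p.2 < δ} n
      ≤ ((⌊Real.exp (h₁ * n)⌋₊ : ℕ) : ℕ∞) := by
    refine iSup₂_le fun s hs => ?_
    rw [Nat.cast_le]
    by_contra hlt
    push Not at hlt
    obtain ⟨u, hu, v, hv, huv, hd⟩ := hcon s (Nat.lt_of_floor_lt hlt).le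
    have hdisj := hs.2 hu hv huv
    have h1 : v ∈ UniformSpace.ball u
        (Dynamics.dynEntourage S {p : Y × Y | dist p.1 p.2 < δ} n) :=
      Dynamics.mem_ball_dynEntourage.2 fun t ht => hd t ht
    have h2 : v ∈ UniformSpace.ball v
        (Dynamics.dynEntourage S {p : Y × Y | dist p.1 p.2 < δ} n) :=
      Dynamics.mem_ball_dynEntourage.2 fun t _ => by simpa [UniformSpace.ball] using hδ0
    exact Set.disjoint_left.1 hdisj h1 h2
  have h3 : EReal.exp ((h₂ : EReal) * n) ≤ ((⌊Real.exp (h₁ * n)⌋₊ : ℕ) : ℝ≥0∞) := by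
    refine hn.trans ?_
    exact_mod_cast hle
  have h4 : ((h₂ : EReal) * n) = ((h₂ * n : ℝ) : EReal) := by simp
  rw [h4, EReal.exp_coe, ← ENNReal.ofReal_natCast, ENNReal.ofReal_le_ofReal_iff (by positivity)]
    at h3
  have h5 := h3.trans (Nat.floor_le (Real.exp_pos _).le)
  rw [Real.exp_le_exp] at h5
  have : (0 : ℝ) < n := by exact_mod_cast hn0
  nlinarith

lemma ZMod.val_add_natCast_eq_mod {M : ℕ} [NeZero M] (r : ZMod M) (i : ℕ) :
    (r + (i : ZMod M)).val = (r.val + i) % M := by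
  rw [ZMod.val_add, ZMod.val_natCast, Nat.add_mod_mod]

/-- Orbits obtained by specification: in every block of length `M` the orbit first follows a
prescribed word, in the middle of a window of length `w`, and then the orbit of `y`. -/
lemma IsGapFunction.exists_block_orbit {Y : Type*} [MetricSpace Y] {S : Y ≃ Y} {ε : ℝ} {L : ℕ → ℕ}
    (hL : IsGapFunction S ε L) {M n₀ g w : ℕ} [NeZero M] (hn₀ : 0 < n₀) (hg : g = L M)
    (hw : w = n₀ + 2 * g) (hwM : w < M) (y : Y) (r : ZMod M) (u : ℕ → Y) (K : ℕ) :
    ∃ z : Y, ∀ i, M ≤ i → i < K →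
      (w ≤ (r + (i : ZMod M)).val → dist (S^[i] z) (S^[i] y) ≤ ε) ∧
      (r + (i : ZMod M) = 0 → ∀ t < n₀, dist (S^[g + t] (S^[i] z)) (S^[t] (u i)) ≤ ε) := by
  obtain ⟨hmono, -, hspec⟩ := hL
  have hrM : r.val < M := ZMod.val_lt r
  have hgM : L M ≤ g := hg.ge
  have hpow : ∀ (i : ℕ) (x : Y), (S ^ (i : ℤ)) x = S^[i] x := fun i x => by
    rw [zpow_natCast, Equiv.Perm.iterate_eq_pow]
  set m : ℕ := M - r.val with hm
  let st : ℕ → ℕ := fun l => m + l * M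
  let tgt : Fin (2 * K) → Y := fun i =>
    if (i : ℕ) % 2 = 0 then (S ^ (-((st (i / 2) + g : ℕ) : ℤ))) (u (st (i / 2))) else y
  let a : Fin (2 * K) → ℤ := fun i =>
    if (i : ℕ) % 2 = 0 then ((st (i / 2) + g : ℕ) : ℤ) else ((st (i / 2) + w : ℕ) : ℤ)
  let b : Fin (2 * K) → ℤ := fun i =>
    if (i : ℕ) % 2 = 0 then ((st (i / 2) + g + n₀ : ℕ) : ℤ) - 1 else ((st (i / 2) + M : ℕ) : ℤ) - 1
  obtain ⟨z, hz⟩ := hspec (2 * K) tgt a b (fun i => by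
      simp only [a, b]
      split_ifs <;> push_cast <;> omega) (fun i j hij => by
      simp only [a, b]
      rcases Nat.mod_two_eq_zero_or_one (i : ℕ) with hi | hi
      · have h1 : (j : ℕ) % 2 = 1 := by omega
        have h2 : (j : ℕ) / 2 = (i : ℕ) / 2 := by omega
        have h3 : ¬ (j : ℕ) % 2 = 0 := by omega
        rw [if_neg h3, if_neg h3, if_pos hi, h2]
        refine le_trans (Nat.cast_le.2 ((hmono (?_ : _ ≤ M)).trans hgM)) ?_
        · push_cast; omega
        · push_cast; omega
      · have h1 : (j : ℕ) % 2 = 0 := by omega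
        have h2 : (j : ℕ) / 2 = (i : ℕ) / 2 + 1 := by omega
        have h4 : ¬ (i : ℕ) % 2 = 0 := by omega
        rw [if_pos h1, if_pos h1, if_neg h4, h2]
        have h3 : st ((i : ℕ) / 2 + 1) = st ((i : ℕ) / 2) + M := by simp only [st]; ring
        refine le_trans (Nat.cast_le.2 ((hmono (?_ : _ ≤ M)).trans hgM)) ?_
        · push_cast; omega
        · rw [h3]; push_cast; omega)
  refine ⟨z, fun i hMi hiK => ?_⟩
  have hdm := Nat.div_add_mod (i - m) M
  set l := (i - m) / M with hl
  set s := (i - m) % M with hs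
  have hsM : s < M := Nat.mod_lt _ (by omega)
  have hi : i = st l + s := by simp only [st]; rw [mul_comm l]; omega
  have hlK : l < K := by
    have : l ≤ i - m := Nat.div_le_self _ _
    omega
  have hval : (r + (i : ZMod M)).val = s := by
    rw [ZMod.val_add_natCast_eq_mod, hs]
    have : r.val + i = (i - m) + M := by omega
    rw [this, Nat.add_mod_right]
  constructor
  · intro hws
    rw [hval] at hws
    have h1 : ((2 * l + 1 : ℕ) % 2) ≠ 0 := by omega
    have h2 : (2 * l + 1) / 2 = l := by omega
    have := hz ⟨2 * l + 1, by omega⟩ (i : ℤ) (by simp only [a, if_neg h1, h2]; omega)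
      (by simp only [b, if_neg h1, h2]; omega)
    simpa only [tgt, if_neg h1, hpow] using this
  · intro h0 t ht
    have hs0 : s = 0 := by rw [← hval, h0, ZMod.val_zero]
    have h1 : ((2 * l : ℕ) % 2) = 0 := by omega
    have h2 : (2 * l) / 2 = l := by omega
    have := hz ⟨2 * l, by omega⟩ ((i + g + t : ℕ) : ℤ) (by simp only [a, if_pos h1, h2]; omega)
      (by simp only [b, if_pos h1, h2]; omega)
    simp only [tgt, if_pos h1, h2] at this
    rw [hpow, hpow] at this
    rw [← hpow (i + g + t) ((S ^ _) _), ← Equiv.Perm.mul_apply, ← zpow_add] at this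
    have h3 : (((i + g + t : ℕ) : ℤ) + -((st l + g : ℕ) : ℤ)) = (t : ℤ) := by push_cast; omega
    have h4 : st l = i := by omega
    rw [h3, hpow, h4, show i + g + t = (g + t) + i by ring, Function.iterate_add_apply] at this
    exact this

section Phase

variable {B : Type*} [TopologicalSpace B] [T2Space B] [CompactSpace B]
  [SecondCountableTopology B] [MeasurableSpace B] [BorelSpace B]

/-- The odometer step appended to a map. -/
def phaseMap {B : Type*} (T : B → B) (M : ℕ) : B × ZMod M → B × ZMod M :=
  Prod.map T (· + 1)

lemma phaseMap_iterate {B : Type*} (T : B → B) (M n : ℕ) (p : B × ZMod M) :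
    (phaseMap T M)^[n] p = (T^[n] p.1, p.2 + n) := by
  induction n with
  | zero => simp
  | succ n ih =>
    rw [Function.iterate_succ_apply', ih, Function.iterate_succ_apply']
    simp [phaseMap, add_assoc]

lemma continuous_phaseMap {B : Type*} [TopologicalSpace B] {T : B → B} (hT : Continuous T) (M : ℕ) :
    Continuous (phaseMap T M) :=
  hT.prodMap (continuous_of_discreteTopology)

lemma exists_ergodic_phaseMap {T : B → B} (hT : Continuous T) {ξ : Measure B}
    [IsProbabilityMeasure ξ] (hξ : Ergodic T ξ) (M : ℕ) [NeZero M] :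
    ∃ l : Measure (B × ZMod M), IsProbabilityMeasure l ∧ Ergodic (phaseMap T M) l ∧
      l.map Prod.fst = ξ := by
  obtain ⟨l, h1, h2, h3, -⟩ := exists_ergodic_lift (continuous_phaseMap hT M)
    (p := Prod.fst) continuous_fst (τ := T) (fun _ => rfl) hξ isClosed_univ
    (fun n => ⟨ξ.prod (Measure.dirac 0), by simp, by simp⟩)
  exact ⟨l, h1, h2, h3⟩

lemma measure_phase_eq {T : B → B} {M : ℕ} [NeZero M] {l : Measure (B × ZMod M)}
    [IsProbabilityMeasure l] (hl : MeasurePreserving (phaseMap T M) l l) (s : ZMod M) :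
    l {p | p.2 = s} = (M : ℝ≥0∞)⁻¹ := by
  have hms : ∀ s : ZMod M, MeasurableSet {p : B × ZMod M | p.2 = s} := fun s =>
    measurable_snd (measurableSet_singleton s)
  have hstep : ∀ n : ℕ, l {p | p.2 = (n : ZMod M)} = l {p | p.2 = 0} := by
    intro n
    have := (hl.iterate n).measure_preimage (hms n).nullMeasurableSet
    rw [← this]
    congr 1
    ext p
    simp [phaseMap_iterate]
  have hall : ∀ s : ZMod M, l {p | p.2 = s} = l {p | p.2 = 0} := fun s => by
    have := hstep s.val
    rwa [ZMod.natCast_zmod_val] at this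
  have hsum : ∑ s : ZMod M, l {p | p.2 = s} = 1 := by
    have h1 : ∑ s : ZMod M, l (Prod.snd ⁻¹' {s}) = 1 := by
      simpa using sum_measure_preimage_singleton (μ := l) (f := Prod.snd)
        (Finset.univ : Finset (ZMod M)) (fun s _ => hms s)
    exact h1
  simp only [hall] at hsum ⊢
  rw [Finset.sum_const, Finset.card_univ, ZMod.card, nsmul_eq_mul, mul_comm] at hsum
  exact ENNReal.eq_inv_of_mul_eq_one_left hsum

/-- Some ergodic lift to the product with an odometer does not increase the entropy of an observable
when it is conditioned on the phase `0`. -/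
lemma exists_ergodic_phaseMap_sum_le {T : B → B} (hT : Continuous T) {ξ : Measure B}
    [IsProbabilityMeasure ξ] (hξ : Ergodic T ξ) (M : ℕ) [NeZero M]
    {α : Type*} [Fintype α] [MeasurableSpace α] [MeasurableSingletonClass α] {f : B → α}
    (hf : Measurable f) :
    ∃ l : Measure (B × ZMod M), IsProbabilityMeasure l ∧ Ergodic (phaseMap T M) l ∧
      l.map Prod.fst = ξ ∧
      ∑ a, Real.negMulLog (M * (l {p | p.2 = 0 ∧ f p.1 = a}).toReal) ≤ infoEntropy ξ f := by
  obtain ⟨l, hl, herg, hmap⟩ := exists_ergodic_phaseMap hT hξ M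
  have hM : (0 : ℝ) < M := by exact_mod_cast NeZero.pos M
  have hms : ∀ (s : ZMod M) a, MeasurableSet {p : B × ZMod M | p.2 = s ∧ f p.1 = a} := fun s a =>
    (measurable_snd (measurableSet_singleton s)).inter
      ((hf.comp measurable_fst) (measurableSet_singleton a))
  let q : ZMod M → α → ℝ := fun s a => (l {p | p.2 = s ∧ f p.1 = a}).toReal
  have hq : ∀ a, ∑ s, q s a = (ξ (f ⁻¹' {a})).toReal := by
    intro a
    have h1 : ξ (f ⁻¹' {a}) = ∑ s : ZMod M, l {p | p.2 = s ∧ f p.1 = a} := by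
      rw [← hmap, Measure.map_apply measurable_fst (hf (measurableSet_singleton a)),
        ← measure_biUnion_finset]
      · congr 1
        ext p
        simp
      · intro s _ s' _ hss
        exact Set.disjoint_left.2 fun p hp hp' => hss (hp.1.symm.trans hp'.1)
      · exact fun s _ => hms s a
    rw [h1, ENNReal.toReal_sum fun _ _ => measure_ne_top _ _]
  have hjensen : ∀ a, ∑ s : ZMod M, (M : ℝ)⁻¹ * Real.negMulLog (M * q s a)
      ≤ Real.negMulLog (ξ (f ⁻¹' {a})).toReal := by
    intro a
    have := Real.concaveOn_negMulLog.le_map_sum (t := (Finset.univ : Finset (ZMod M)))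
      (w := fun _ => (M : ℝ)⁻¹) (p := fun s => M * q s a) (fun _ _ => by positivity)
      (by rw [Finset.sum_const, Finset.card_univ, ZMod.card, nsmul_eq_mul, mul_inv_cancel₀ hM.ne'])
      (fun s _ => by simp only [mem_Ici, q]; positivity)
    simp only [smul_eq_mul, inv_mul_cancel_left₀ hM.ne', hq] at this
    exact this
  have havg : ∑ s : ZMod M, (∑ a, Real.negMulLog (M * q s a)) ≤ ∑ _s : ZMod M, infoEntropy ξ f := by
    rw [Finset.sum_const, Finset.card_univ, ZMod.card, nsmul_eq_mul, Finset.sum_comm,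
      ← inv_mul_le_iff₀ hM, Finset.mul_sum]
    refine Finset.sum_le_sum fun a _ => ?_
    rw [Finset.mul_sum]
    exact hjensen a
  obtain ⟨s, -, hs⟩ := Finset.exists_le_of_sum_le ⟨0, Finset.mem_univ _⟩ havg
  let ρ : B × ZMod M → B × ZMod M := Prod.map id (· - s)
  have hρ : Measurable ρ := measurable_id.prodMap (measurable_of_countable _)
  refine ⟨l.map ρ, Measure.isProbabilityMeasure_map hρ.aemeasurable, ?_, ?_, ?_⟩
  · refine MeasurePreserving.ergodic_of_ergodic_semiconj ⟨hρ, rfl⟩ herg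
      (hT.measurable.prodMap (measurable_of_countable _)) fun p => ?_
    exact Prod.ext rfl (by show p.2 + 1 - s = p.2 - s + 1; ring)
  · rw [Measure.map_map measurable_fst hρ, ← hmap]
    rfl
  · refine (Finset.sum_congr rfl fun a _ => ?_).trans_le hs
    rw [Measure.map_apply hρ (hms 0 a)]
    congr 4
    ext p
    simp [ρ, sub_eq_zero]

end Phase

section Tracking

variable {B : Type*} [TopologicalSpace B] [T2Space B] [CompactSpace B]
  [SecondCountableTopology B] [MeasurableSpace B] [BorelSpace B]
  {Y : Type*} [MetricSpace Y] [CompactSpace Y] [MeasurableSpace Y] [BorelSpace Y]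

/-- A measurable choice, among countably many points, of one whose first iterates approximate
those of the given point. -/
lemma exists_measurable_countable_approx [Nonempty Y] {S : Y → Y} (hS : Continuous S) {ε : ℝ}
    (hε : 0 < ε) (N : ℕ) :
    ∃ j : Y → ℕ, Measurable j ∧ ∃ c : ℕ → Y, ∀ y, ∀ i < N, dist (S^[i] (c (j y))) (S^[i] y) < ε := by
  have hex : ∀ y, ∃ j, ∀ i < N, dist (S^[i] (TopologicalSpace.denseSeq Y j)) (S^[i] y) < ε := by
    intro y
    have hopen : IsOpen (⋂ i ∈ Finset.range N, {v | dist (S^[i] v) (S^[i] y) < ε}) :=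
      isOpen_biInter_finset fun i _ =>
        isOpen_lt ((hS.iterate i).dist continuous_const) continuous_const
    obtain ⟨j, hv⟩ := (TopologicalSpace.denseRange_denseSeq Y).exists_mem_open hopen
      ⟨y, by simpa using fun _ _ => hε⟩
    exact ⟨j, by simpa using hv⟩
  classical
  refine ⟨fun y => Nat.find (hex y), measurable_find hex fun j => ?_,
    TopologicalSpace.denseSeq Y, fun y => Nat.find_spec (hex y)⟩
  have : {y | ∀ i < N, dist (S^[i] (TopologicalSpace.denseSeq Y j)) (S^[i] y) < ε}
      = ⋂ i ∈ Finset.range N, {y | dist (S^[i] (TopologicalSpace.denseSeq Y j)) (S^[i] y) < ε} := by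
    ext; simp
  rw [this]
  exact (isOpen_biInter_finset fun i _ =>
    isOpen_lt (continuous_const.dist (hS.iterate i)) continuous_const).measurableSet

lemma exists_ergodic_block_tracking (S : Y ≃ₜ Y) {T : B → B} (hT : Continuous T) {π : B → Y}
    (hπ : Continuous π) (hsemi : Function.Semiconj π T S) {ε : ℝ} (hε : 0 < ε) {L : ℕ → ℕ}
    (hL : IsGapFunction S.toEquiv ε L) {M n₀ g w : ℕ} [NeZero M] (hn₀ : 0 < n₀) (hg : g = L M)
    (hw : w = n₀ + 2 * g) (hwM : w < M)
    {E : Type*} [Finite E] [TopologicalSpace E] [DiscreteTopology E] [MeasurableSpace E]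
    [BorelSpace E] (u : Measure E) [IsProbabilityMeasure u] (word : E → Y)
    {l : Measure (B × ZMod M)} [IsProbabilityMeasure l] (hl : Ergodic (phaseMap T M) l) :
    ∃ Ξ : Measure (((B × ZMod M) × (ℕ → E)) × Y), IsProbabilityMeasure Ξ ∧
      Ergodic (Prod.map (Prod.map (phaseMap T M) leftShift) S) Ξ ∧
      Ξ.map Prod.fst = l.prod (Measure.infinitePi fun _ => u) ∧
      ∀ᵐ x ∂Ξ, (w ≤ x.1.1.2.val → dist x.2 (π x.1.1.1) ≤ 2 * ε) ∧
        (x.1.1.2 = 0 → ∀ t < n₀, dist (S^[g + t] x.2) (S^[t] (word (x.1.2 0))) ≤ ε) := by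
  have : Nonempty B := by
    obtain ⟨p⟩ := l.nonempty_of_neZero
    exact ⟨p.1⟩
  have : Nonempty Y := this.map π
  let τ : (B × ZMod M) × (ℕ → E) → (B × ZMod M) × (ℕ → E) := Prod.map (phaseMap T M) leftShift
  let P : Measure ((B × ZMod M) × (ℕ → E)) := l.prod (Measure.infinitePi fun _ => u)
  let G : ((B × ZMod M) × (ℕ → E)) × Y → ((B × ZMod M) × (ℕ → E)) × Y := Prod.map τ S
  have hτ : Continuous τ := (continuous_phaseMap hT M).prodMap continuous_leftShift
  have hG : Continuous G := hτ.prodMap S.continuous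
  have hP : Ergodic τ P := ergodic_prodMap_leftShift hl u
  let F : Set (((B × ZMod M) × (ℕ → E)) × Y) := {x | (w ≤ x.1.1.2.val → dist x.2 (π x.1.1.1) ≤ 2 * ε) ∧
        (x.1.1.2 = 0 → ∀ t < n₀, dist (S^[g + t] x.2) (S^[t] (word (x.1.2 0))) ≤ ε)}
  have hF : IsClosed F := by
    have hph : Continuous fun x : ((B × ZMod M) × (ℕ → E)) × Y => x.1.1.2 := by fun_prop
    have hS : ∀ t, Continuous (S^[t]) := fun t => S.continuous.iterate t
    have h1 : IsClosed {x : ((B × ZMod M) × (ℕ → E)) × Y |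
        w ≤ x.1.1.2.val → dist x.2 (π x.1.1.1) ≤ 2 * ε} := by
      refine isClosed_imp ((isOpen_discrete {s : ZMod M | w ≤ s.val}).preimage hph) ?_
      exact isClosed_le (by fun_prop) continuous_const
    have h2 : IsClosed {x : ((B × ZMod M) × (ℕ → E)) × Y | x.1.1.2 = 0 → ∀ t < n₀,
        dist (S^[g + t] x.2) (S^[t] (word (x.1.2 0))) ≤ ε} := by
      refine isClosed_imp ((isOpen_discrete {s : ZMod M | s = 0}).preimage hph) ?_
      simp only [ofPred_forall]
      refine isClosed_iInter fun t => isClosed_iInter fun _ => isClosed_le ?_ continuous_const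
      refine ((hS (g + t)).comp continuous_snd).dist ((hS t).comp ?_)
      exact (continuous_of_discreteTopology (f := word)).comp (by fun_prop)
    exact h1.inter h2
  suffices hne : ∀ n, ∃ Θ : Measure (((B × ZMod M) × (ℕ → E)) × Y), Θ.map Prod.fst = P ∧
      ∀ i < n, Θ (G^[i] ⁻¹' F)ᶜ = 0 from
    exists_ergodic_lift hG (p := Prod.fst) continuous_fst (τ := τ) (fun _ => rfl) hP hF hne
  intro n
  obtain ⟨j, hj, c, hjc⟩ := exists_measurable_countable_approx S.continuous hε (M + n)
  have hex : ∀ q : ℕ × ZMod M × (Fin (M + n) → E), ∃ z : Y, ∀ i, M ≤ i → ∀ hi : i < M + n,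
      (w ≤ (q.2.1 + (i : ZMod M)).val → dist (S^[i] z) (S^[i] (c q.1)) ≤ ε) ∧
      (q.2.1 + (i : ZMod M) = 0 → ∀ t < n₀,
        dist (S^[g + t] (S^[i] z)) (S^[t] (word (q.2.2 ⟨i, hi⟩))) ≤ ε) := by
    intro q
    obtain ⟨z, hz⟩ := hL.exists_block_orbit hn₀ hg hw hwM (c q.1) q.2.1
      (fun i => if hi : i < M + n then word (q.2.2 ⟨i, hi⟩) else c 0) (M + n)
    refine ⟨z, fun i hi hi' => ⟨(hz i hi hi').1, fun h t ht => ?_⟩⟩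
    simpa [hi'] using (hz i hi hi').2 h t ht
  choose z hz using hex
  let key : (B × ZMod M) × (ℕ → E) → ℕ × ZMod M × (Fin (M + n) → E) := fun d =>
    (j (π d.1.1), d.1.2, fun i => d.2 i)
  have hkey : Measurable key := by
    refine (hj.comp (hπ.measurable.comp (measurable_fst.comp measurable_fst))).prodMk
      ((measurable_snd.comp measurable_fst).prodMk (measurable_pi_lambda _ fun i => ?_))
    exact (measurable_pi_apply _).comp measurable_snd
  let s : (B × ZMod M) × (ℕ → E) → ((B × ZMod M) × (ℕ → E)) × Y := fun d => (d, z (key d))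
  have hs : Measurable s := measurable_id.prodMk ((measurable_of_countable z).comp hkey)
  refine ⟨(P.map s).map G^[M], ?_, fun i hi => ?_⟩
  · have h1 : (Prod.fst ∘ G^[M]) ∘ s = τ^[M] := by
      ext1 d
      simp [s, G, Prod.map_iterate]
    rw [Measure.map_map measurable_fst (hG.measurable.iterate M),
      Measure.map_map (measurable_fst.comp (hG.measurable.iterate M)) hs, h1]
    exact (hP.toMeasurePreserving.iterate M).map_eq
  · have hmeas : MeasurableSet (G^[i] ⁻¹' F)ᶜ :=
      ((hF.preimage (hG.iterate i)).measurableSet).compl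
    rw [Measure.map_map (hG.measurable.iterate M) hs,
      Measure.map_apply ((hG.measurable.iterate M).comp hs) hmeas]
    convert measure_empty (μ := P)
    refine Set.eq_empty_of_forall_notMem fun d hd => hd ?_
    have hit : G^[i] (G^[M] (s d)) = (((T^[i + M] d.1.1, d.1.2 + ((i + M : ℕ) : ZMod M)),
        leftShift^[i + M] d.2), S^[i + M] (z (key d))) := by
      rw [← Function.iterate_add_apply]
      simp only [G, τ, Prod.map_iterate]
      exact Prod.ext (Prod.ext (phaseMap_iterate T M (i + M) d.1) rfl) rfl
    show G^[i] (G^[M] (s d)) ∈ F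
    rw [hit]
    obtain ⟨h1, h2⟩ := hz (key d) (i + M) (by omega) (by omega)
    refine ⟨fun h => ?_, fun h t ht => ?_⟩
    · have h3 := hjc (π d.1.1) (i + M) (by omega)
      have h4 : π (T^[i + M] d.1.1) = S^[i + M] (π d.1.1) := hsemi.iterate_right (i + M) d.1.1
      have h5 := dist_triangle (S^[i + M] (z (key d))) (S^[i + M] (c (j (π d.1.1))))
        (S^[i + M] (π d.1.1))
      have h6 := h1 h
      show dist (S^[i + M] (z (key d))) (π (T^[i + M] d.1.1)) ≤ 2 * ε
      rw [h4]
      have h7 : dist (S^[i + M] (z (key d))) (S^[i + M] (c (j (π d.1.1)))) ≤ ε := h6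
      linarith
    · have := h2 h t ht
      simpa [leftShift_iterate_apply, key] using this

end Tracking

/-- The time of the `l`-th return, after time `0`, of the phase `s` to `0`. -/
def blockStart {M : ℕ} (s : ZMod M) (l : ℕ) : ℕ := M - s.val + l * M

lemma add_blockStart {M : ℕ} [NeZero M] (s : ZMod M) (l : ℕ) : s + (blockStart s l : ZMod M) = 0 := by
  have h := (ZMod.val_lt s).le
  simp [blockStart, Nat.cast_sub h]

lemma blockStart_injective {M : ℕ} [NeZero M] (s : ZMod M) : Function.Injective (blockStart s) :=
  fun _ _ h => Nat.eq_of_mul_eq_mul_right (NeZero.pos M) (Nat.add_left_cancel h)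

lemma blockStart_le {M : ℕ} (s : ZMod M) (l : ℕ) : blockStart s l ≤ M + l * M :=
  Nat.add_le_add_right (Nat.sub_le _ _) _

lemma exists_eq_blockStart_add {M : ℕ} [NeZero M] (s : ZMod M) {w q j : ℕ} (hj : M ≤ j)
    (hjq : j < q * M) (hw : (s + (j : ZMod M)).val < w) :
    ∃ l < q, ∃ t < w, j = blockStart s l + t := by
  have hM := NeZero.pos M
  have hs := ZMod.val_lt s
  rw [ZMod.val_add_natCast_eq_mod] at hw
  have hdm := Nat.div_add_mod (s.val + j) M
  obtain ⟨c, hc⟩ : ∃ c, (s.val + j) / M = c + 1 :=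
    Nat.exists_eq_succ_of_ne_zero (Nat.div_pos (by omega) hM).ne'
  rw [hc] at hdm
  refine ⟨c, ?_, _, hw, ?_⟩
  · by_contra hcq
    have := Nat.mul_le_mul_right M (not_lt.1 hcq)
    have h2 : M * (c + 1) = c * M + M := by ring
    omega
  · have h2 : M * (c + 1) = c * M + M := by ring
    unfold blockStart
    omega

section BlockEntropy

variable {W : Type*} [MeasurableSpace W] {Ξ : Measure W}

lemma infoEntropy_le_of_ae_determined [IsProbabilityMeasure Ξ] {α β : Type*} [Fintype α]
    [Fintype β] [MeasurableSpace α]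
    [MeasurableSingletonClass α] {f : W → α} (hf : Measurable f) {h : W → β} {N : W → Prop}
    (hN : ∀ᵐ x ∂Ξ, N x) (hdet : ∀ x x', N x → N x' → f x = f x' → h x = h x') :
    infoEntropy Ξ h ≤ infoEntropy Ξ f := by
  classical
  have hW : Nonempty W := Ξ.nonempty_of_neZero
  refine infoEntropy_le_of_ae_eq_comp hf
    (fun v => if hv : ∃ x, N x ∧ f x = v then h hv.choose else h hW.some) ?_
  filter_upwards [hN] with x hx
  have hv : ∃ x', N x' ∧ f x' = f x := ⟨x, hx, rfl⟩
  rw [dif_pos hv]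
  exact hdet _ _ hx hv.choose_spec.1 hv.choose_spec.2.symm

variable {G : W → W} {M : ℕ} [NeZero M] {φ : W → ZMod M}

lemma phase_iterate {W : Type*} {G : W → W} {M : ℕ} {φ : W → ZMod M}
    (hφG : ∀ x, φ (G x) = φ x + 1) (n : ℕ) (x : W) : φ (G^[n] x) = φ x + n := by
  induction n with
  | zero => simp
  | succ n ih => rw [Function.iterate_succ_apply', hφG, ih]; push_cast; ring

lemma measure_phase_blockStart (hG : MeasurePreserving G Ξ Ξ) (hφ : Measurable φ)
    (hφG : ∀ x, φ (G x) = φ x + 1) {D : Set W} (hD : MeasurableSet D) (l : ℕ) :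
    Ξ {x | G^[blockStart (φ x) l] x ∈ D} = M * Ξ ({x | φ x = 0} ∩ D) := by
  have h0 : MeasurableSet ({x | φ x = 0} ∩ D) := (hφ (measurableSet_singleton 0)).inter hD
  have hset : ∀ s : ZMod M, {x | φ x = s ∧ G^[blockStart s l] x ∈ D}
      = G^[blockStart s l] ⁻¹' ({x | φ x = 0} ∩ D) := by
    intro s
    ext x
    simp only [mem_ofPred_eq, mem_preimage, mem_inter_iff, phase_iterate hφG]
    refine and_congr_left fun _ => ⟨fun h => h ▸ add_blockStart s l, fun h => ?_⟩
    exact add_right_cancel (h.trans (add_blockStart s l).symm)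
  have hun : {x | G^[blockStart (φ x) l] x ∈ D}
      = ⋃ s ∈ (Finset.univ : Finset (ZMod M)), {x | φ x = s ∧ G^[blockStart s l] x ∈ D} := by
    ext x
    simp
  rw [hun, measure_biUnion_finset]
  · simp_rw [hset, (hG.iterate _).measure_preimage h0.nullMeasurableSet]
    rw [Finset.sum_const, Finset.card_univ, ZMod.card, nsmul_eq_mul]
  · intro s _ s' _ hss
    exact Set.disjoint_left.2 fun p hp hp' => hss (hp.1.symm.trans hp'.1)
  · intro s _
    rw [hset]
    exact (hG.iterate _).measurable h0

variable {α A E β : Type*} [Fintype α] [MeasurableSpace α] [MeasurableSingletonClass α]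
  [Fintype A] [MeasurableSpace A] [MeasurableSingletonClass A]
  [Fintype β] [MeasurableSpace β] [MeasurableSingletonClass β] [Fintype E] [Nonempty E]
  {p : W → α} {a : W → A} {b : W → β} {e : W → E} {w n₀ g : ℕ}

lemma infoEntropy_blocks_le [IsProbabilityMeasure Ξ] (hG : MeasurePreserving G Ξ Ξ) (hφ : Measurable φ)
    (hφG : ∀ x, φ (G x) = φ x + 1) (hp : Measurable p) (ha : Measurable a) (hb : Measurable b)
    (hind : ∀ (n m : ℕ) (s : ZMod M) (v : Fin n → α) (idx : Fin m → ℕ) (c : Fin m → E),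
      Function.Injective idx →
      Ξ ({x | (fun l => e (G^[idx l] x)) = c} ∩ {x | (fun i : Fin n => p (G^[i] x)) = v ∧ φ x = s})
        = ((Fintype.card E : ℝ≥0∞) ^ m)⁻¹ *
          Ξ {x | (fun i : Fin n => p (G^[i] x)) = v ∧ φ x = s})
    (dec : (Fin n₀ → A) → E)
    (hdec : ∀ᵐ x ∂Ξ, φ x = 0 → e x = dec fun t : Fin n₀ => a (G^[g + t] x))
    (hgw : g + n₀ ≤ w) (hwM : w < M) (dcd : A → β → α)
    (hdcd : ∀ᵐ x ∂Ξ, w ≤ (φ x).val → p x = dcd (a x) (b x))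
    {τ Hw : ℝ} (hτ : infoEntropy Ξ b ≤ τ)
    (hHw : ∑ v : Fin w → α,
      Real.negMulLog (M * (Ξ {x | φ x = 0 ∧ (fun i : Fin w => p (G^[i] x)) = v}).toReal) ≤ Hw)
    (q : ℕ) :
    q * Real.log (Fintype.card E) +
        infoEntropy Ξ (fun x => fun i : Fin ((q + 1) * M) => p (G^[(i : ℕ)] x)) ≤
      infoEntropy Ξ (fun x => fun i : Fin ((q + 1) * M) => a (G^[(i : ℕ)] x)) +
        (Real.log M + ((q + 1) * M : ℕ) * τ + q * Hw + 2 * M * Real.log (Fintype.card α)) := by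
  classical
  have hW : Nonempty W := Ξ.nonempty_of_neZero
  have : Nonempty α := hW.map p
  set n := (q + 1) * M with hn
  have hnq : n = q * M + M := by rw [hn]; ring
  have hGm := hG.measurable
  have hpn := measurable_itinerary hGm hp
  let U : W → Fin q → E := fun x l => e (G^[blockStart (φ x) l] x)
  let gY : W → (Fin n → α) × ZMod M := fun x => (fun i : Fin n => p (G^[i] x), φ x)
  have hgY : Measurable gY := (hpn n).prodMk hφ
  have hleft : q * Real.log (Fintype.card E) +
      infoEntropy Ξ (fun x => fun i : Fin n => p (G^[(i : ℕ)] x))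
      ≤ infoEntropy Ξ (fun x => (U x, gY x)) := by
    rw [infoEntropy_prodMk_of_uniform hgY]
    · rw [Fintype.card_fun, Fintype.card_fin, Nat.cast_pow, Real.log_pow]
      gcongr
      exact infoEntropy_comp_le hgY Prod.fst
    · rintro c ⟨v, s⟩
      have h1 : gY ⁻¹' {(v, s)} = {x | (fun i : Fin n => p (G^[i] x)) = v ∧ φ x = s} := by
        ext x; simp [gY]
      have h2 : U ⁻¹' {c} ∩ gY ⁻¹' {(v, s)}
          = {x | (fun l : Fin q => e (G^[blockStart s l] x)) = c} ∩
            {x | (fun i : Fin n => p (G^[i] x)) = v ∧ φ x = s} := by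
        rw [h1]
        ext x
        simp only [mem_inter_iff, mem_preimage, mem_singleton_iff, mem_ofPred_eq, U]
        refine and_congr_left ?_
        rintro ⟨-, rfl⟩
        rfl
      rw [h2, h1, hind n q s v (fun l => blockStart s l) c
        fun l l' h => Fin.ext (blockStart_injective s h), Fintype.card_fun, Fintype.card_fin,
        Nat.cast_pow]
  let yw : W → Fin w → α := fun x i => p (G^[i] x)
  let fA : W → Fin n → A := fun x i => a (G^[(i : ℕ)] x)
  let fB : W → Fin n → β := fun x i => b (G^[(i : ℕ)] x)
  let fY : W → Fin q → Fin w → α := fun x l => yw (G^[blockStart (φ x) l] x)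
  let fS : W → Fin M → α := fun x i => p (G^[(i : ℕ)] x)
  let fT : W → Fin M → α := fS ∘ G^[q * M]
  have hfA : Measurable fA := measurable_itinerary hGm ha n
  have hfB : Measurable fB := measurable_itinerary hGm hb n
  have hyw : Measurable yw := hpn w
  have hfS : Measurable fS := hpn M
  have hfT : Measurable fT := hfS.comp (hGm.iterate _)
  have hYl : ∀ l : Fin q, Measurable fun x => yw (G^[blockStart (φ x) l] x) := by
    intro l
    have h1 : Measurable fun z : W × ZMod M => yw (G^[blockStart z.2 l] z.1) :=
      measurable_from_prod_countable_left fun s => hyw.comp (hGm.iterate (blockStart s l))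
    exact h1.comp (measurable_id.prodMk hφ)
  have hfY : Measurable fY := measurable_pi_lambda _ hYl
  have hright : infoEntropy Ξ (fun x => (U x, gY x))
      ≤ infoEntropy Ξ (fun x => (fA x, φ x, fB x, fY x, fS x, fT x)) := by
    refine infoEntropy_le_of_ae_determined
      (hfA.prodMk (hφ.prodMk (hfB.prodMk (hfY.prodMk (hfS.prodMk hfT)))))
      (N := fun x => ∀ i, (φ (G^[i] x) = 0 →
        e (G^[i] x) = dec fun t : Fin n₀ => a (G^[g + t] (G^[i] x))) ∧
        (w ≤ (φ (G^[i] x)).val → p (G^[i] x) = dcd (a (G^[i] x)) (b (G^[i] x)))) ?_ ?_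
    · exact ae_all_iff.2 fun i => (hG.iterate i).quasiMeasurePreserving.ae (hdec.and hdcd)
    · intro x x' hx hx' hxx
      simp only [Prod.mk.injEq] at hxx
      obtain ⟨h1, h2, h3, h4, h5, h6⟩ := hxx
      have hA : ∀ j < n, a (G^[j] x) = a (G^[j] x') := fun j hj => congrFun h1 ⟨j, hj⟩
      have hB : ∀ j < n, b (G^[j] x) = b (G^[j] x') := fun j hj => congrFun h3 ⟨j, hj⟩
      have hqM : ∀ l < q, blockStart (φ x) l + w < n := by
        intro l hl
        have := blockStart_le (φ x) l
        have := Nat.mul_le_mul_right M (Nat.succ_le_of_lt hl)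
        rw [Nat.succ_mul] at this
        omega
      refine Prod.ext (funext fun l => ?_) (Prod.ext (funext fun i => ?_) h2)
      · show e (G^[blockStart (φ x) l] x) = e (G^[blockStart (φ x') l] x')
        rw [(hx _).1 (by rw [phase_iterate hφG, add_blockStart]),
          (hx' _).1 (by rw [phase_iterate hφG, add_blockStart]), ← h2]
        congr 1
        funext t
        rw [← Function.iterate_add_apply, ← Function.iterate_add_apply]
        have := hqM l l.2
        exact hA _ (by omega)
      · show p (G^[(i : ℕ)] x) = p (G^[(i : ℕ)] x')
        obtain ⟨j, hj⟩ := i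
        show p (G^[j] x) = p (G^[j] x')
        by_cases hjM : j < M
        · exact congrFun h5 ⟨j, hjM⟩
        by_cases hjq : j < q * M
        · by_cases hjw : (φ x + (j : ZMod M)).val < w
          · obtain ⟨l, hl, t, ht, rfl⟩ := exists_eq_blockStart_add (φ x) (not_lt.1 hjM) hjq hjw
            have := congrFun (congrFun h4 ⟨l, hl⟩) ⟨t, ht⟩
            simp only [fY, yw, ← Function.iterate_add_apply, ← h2] at this
            rwa [add_comm]
          · rw [(hx j).2 (by rw [phase_iterate hφG]; omega),
              (hx' j).2 (by rw [phase_iterate hφG, ← h2]; omega), hA j hj, hB j hj]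
        · have := congrFun h6 ⟨j - q * M, by omega⟩
          simp only [fT, fS, Function.comp, ← Function.iterate_add_apply] at this
          rwa [Nat.sub_add_cancel (not_lt.1 hjq)] at this
  have hcard : ∀ {f : W → Fin M → α}, Measurable f →
      infoEntropy Ξ f ≤ M * Real.log (Fintype.card α) := by
    intro f hf
    refine (infoEntropy_le_log_card hf).trans_eq ?_
    rw [Fintype.card_fun, Fintype.card_fin, Nat.cast_pow, Real.log_pow]
  have hHφ : infoEntropy Ξ φ ≤ Real.log M := by
    simpa [ZMod.card] using infoEntropy_le_log_card (μ := Ξ) hφ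
  have hHB : infoEntropy Ξ fB ≤ n * τ := by
    refine (infoEntropy_pi_le n fun i : Fin n => hb.comp (hGm.iterate i)).trans ?_
    refine (Finset.sum_le_card_nsmul _ _ τ fun i _ => ?_).trans_eq (by simp)
    rwa [infoEntropy_comp_measurePreserving (hG.iterate i) hb]
  have hHY : infoEntropy Ξ fY ≤ q * Hw := by
    refine (infoEntropy_pi_le q hYl).trans ?_
    refine (Finset.sum_le_card_nsmul _ _ Hw fun l _ => ?_).trans_eq (by simp)
    refine Eq.trans_le (Finset.sum_congr rfl fun v _ => ?_) hHw
    have h := measure_phase_blockStart hG hφ hφG (hyw (measurableSet_singleton v)) l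
    have h' : (fun x => yw (G^[blockStart (φ x) l] x)) ⁻¹' {v}
        = {x | G^[blockStart (φ x) l] x ∈ yw ⁻¹' {v}} := rfl
    rw [h', h, ENNReal.toReal_mul, ENNReal.toReal_natCast]
    rfl
  have hsum : infoEntropy Ξ (fun x => (fA x, φ x, fB x, fY x, fS x, fT x))
      ≤ infoEntropy Ξ fA + (infoEntropy Ξ φ + (infoEntropy Ξ fB + (infoEntropy Ξ fY +
        (infoEntropy Ξ fS + infoEntropy Ξ fT)))) := by
    have i1 := infoEntropy_prodMk_le (μ := Ξ) hfS hfT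
    have i2 := infoEntropy_prodMk_le (μ := Ξ) hfY (hfS.prodMk hfT)
    have i3 := infoEntropy_prodMk_le (μ := Ξ) hfB (hfY.prodMk (hfS.prodMk hfT))
    have i4 := infoEntropy_prodMk_le (μ := Ξ) hφ (hfB.prodMk (hfY.prodMk (hfS.prodMk hfT)))
    have i5 := infoEntropy_prodMk_le (μ := Ξ) hfA
      (hφ.prodMk (hfB.prodMk (hfY.prodMk (hfS.prodMk hfT))))
    linarith
  have c1 := hcard hfS
  have c2 := hcard hfT
  have := hleft.trans (hright.trans hsum)
  show _ ≤ infoEntropy Ξ fA + _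
  linarith

lemma log_card_div_add_entropyWrt_le [IsProbabilityMeasure Ξ] (hG : MeasurePreserving G Ξ Ξ)
    (hφ : Measurable φ)
    (hφG : ∀ x, φ (G x) = φ x + 1) (hp : Measurable p) (ha : Measurable a) (hb : Measurable b)
    (hind : ∀ (n m : ℕ) (s : ZMod M) (v : Fin n → α) (idx : Fin m → ℕ) (c : Fin m → E),
      Function.Injective idx →
      Ξ ({x | (fun l => e (G^[idx l] x)) = c} ∩ {x | (fun i : Fin n => p (G^[i] x)) = v ∧ φ x = s})
        = ((Fintype.card E : ℝ≥0∞) ^ m)⁻¹ *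
          Ξ {x | (fun i : Fin n => p (G^[i] x)) = v ∧ φ x = s})
    (dec : (Fin n₀ → A) → E)
    (hdec : ∀ᵐ x ∂Ξ, φ x = 0 → e x = dec fun t : Fin n₀ => a (G^[g + t] x))
    (hgw : g + n₀ ≤ w) (hwM : w < M) (dcd : A → β → α)
    (hdcd : ∀ᵐ x ∂Ξ, w ≤ (φ x).val → p x = dcd (a x) (b x))
    {τ Hw : ℝ} (hτ : infoEntropy Ξ b ≤ τ)
    (hHw : ∑ v : Fin w → α,
      Real.negMulLog (M * (Ξ {x | φ x = 0 ∧ (fun i : Fin w => p (G^[i] x)) = v}).toReal) ≤ Hw) :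
    Real.log (Fintype.card E) / M + entropyWrt Ξ G p ≤ entropyWrt Ξ G a + τ + Hw / M := by
  have hM : (0 : ℝ) < M := by exact_mod_cast NeZero.pos M
  let n : ℕ → ℕ := fun q => (q + 1) * M
  have hn : Tendsto n atTop atTop :=
    tendsto_atTop_mono (fun q => (Nat.le_succ q).trans (Nat.le_mul_of_pos_right _ (NeZero.pos M)))
      tendsto_id
  have hnR : Tendsto (fun q => (n q : ℝ)) atTop atTop := tendsto_natCast_atTop_atTop.comp hn
  have hq : Tendsto (fun q : ℕ => (q : ℝ) / n q) atTop (nhds (1 / M)) := by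
    have := (tendsto_natCast_div_add_atTop (1 : ℝ)).div_const (M : ℝ)
    refine this.congr fun q => ?_
    rw [div_div]
    push_cast [n]
    rfl
  have hconst : ∀ c : ℝ, Tendsto (fun q => c / (n q : ℝ)) atTop (nhds 0) := fun c =>
    tendsto_const_nhds.div_atTop hnR
  have hlim₁ := (hq.mul_const (Real.log (Fintype.card E))).add
    ((tendsto_infoEntropy_itinerary_div hG hp).comp hn)
  have hlim₂ := (((tendsto_infoEntropy_itinerary_div hG ha).comp hn).add_const τ).add
    ((hq.mul_const Hw).add (hconst (Real.log M + 2 * M * Real.log (Fintype.card α))))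
  have key := le_of_tendsto_of_tendsto' hlim₁ hlim₂ fun q => ?_
  · calc _ = 1 / M * Real.log (Fintype.card E) + entropyWrt Ξ G p := by ring
      _ ≤ _ := key
      _ = _ := by ring
  · have h := infoEntropy_blocks_le hG hφ hφG hp ha hb hind dec hdec hgw hwM dcd hdcd hτ hHw q
    have hnq : (0 : ℝ) < n q := by
      have : 0 < n q := Nat.mul_pos q.succ_pos (NeZero.pos M)
      exact_mod_cast this
    have h2 := div_le_div_of_nonneg_right h hnq.le
    simp only [Function.comp]
    refine (le_of_eq ?_).trans (h2.trans (le_of_eq ?_))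
    · show _ = _ / (n q : ℝ)
      simp only [n]
      ring
    · show _ / (n q : ℝ) = _
      change (infoEntropy Ξ (fun x => fun i : Fin (n q) => a (G^[(i : ℕ)] x)) +
        (Real.log M + (n q : ℝ) * τ + q * Hw + 2 * M * Real.log (Fintype.card α))) / (n q : ℝ) = _
      field_simp
      ring

end BlockEntropy

lemma infoEntropy_le_of_measure_ne_le {Ω : Type*} [MeasurableSpace Ω] {μ : Measure Ω}
    [IsProbabilityMeasure μ] {α : Type*} [Fintype α] [MeasurableSpace α]
    [MeasurableSingletonClass α] {f : Ω → α} (hf : Measurable f) (o : α) {η τ : ℝ} (hη0 : 0 ≤ η)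
    (hη : ∀ x, 0 ≤ x → x ≤ η → Real.negMulLog x ≤ τ ∧ Real.negMulLog (1 - x) ≤ τ)
    (hμ : μ {x | f x ≠ o} ≤ ENNReal.ofReal η) :
    infoEntropy μ f ≤ Fintype.card α * τ := by
  refine (Finset.sum_le_card_nsmul _ _ τ fun a _ => ?_).trans_eq (by simp)
  have hμ' : μ.real {x | f x ≠ o} ≤ η := ENNReal.toReal_le_of_le_ofReal hη0 hμ
  by_cases ha : a = o
  · subst ha
    have h1 : f ⁻¹' {a} = {x | f x ≠ a}ᶜ := by
      ext x; simp
    have h2 : MeasurableSet {x | f x ≠ a} := (hf (measurableSet_singleton a)).compl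
    have h3 : (μ (f ⁻¹' {a})).toReal = 1 - μ.real {x | f x ≠ a} := by
      rw [h1, ← probReal_compl_eq_one_sub h2]
      rfl
    rw [h3]
    exact (hη _ measureReal_nonneg hμ').2
  · refine (hη _ ENNReal.toReal_nonneg ((measureReal_mono fun x hx => ?_).trans hμ')).1
    rw [mem_preimage, mem_singleton_iff] at hx
    rw [mem_ofPred_eq, hx]
    exact ha

lemma exists_negMulLog_le {τ : ℝ} (hτ : 0 < τ) :
    ∃ η > 0, ∀ x, 0 ≤ x → x ≤ η → Real.negMulLog x ≤ τ ∧ Real.negMulLog (1 - x) ≤ τ := by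
  have h1 : ∀ᶠ x in nhds (0 : ℝ), Real.negMulLog x < τ :=
    Real.continuous_negMulLog.continuousAt.eventually_lt_const (by simpa using hτ)
  have h2 : ∀ᶠ x in nhds (0 : ℝ), Real.negMulLog (1 - x) < τ :=
    (Real.continuous_negMulLog.comp (continuous_const.sub continuous_id)).continuousAt.eventually_lt_const
      (by simpa using hτ)
  obtain ⟨η, hη, h⟩ := Metric.eventually_nhds_iff.1 (h1.and h2)
  refine ⟨η / 2, by positivity, fun x hx hxη => ?_⟩
  have := @h x (by rw [Real.dist_0_eq_abs, abs_of_nonneg hx]; linarith)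
  exact ⟨this.1.le, this.2.le⟩

/-- A finite-valued observable on a compact space agrees, off a small set, with one that is stable
under small displacements. -/
lemma exists_stable_observable {Y : Type*} [MetricSpace Y] [CompactSpace Y] [MeasurableSpace Y]
    [BorelSpace Y] (ν : Measure Y) [IsFiniteMeasure ν] {k : ℕ} {P : Y → Fin k} (hP : Measurable P)
    {η : ℝ} (hη : 0 < η) :
    ∃ r > 0, ∃ K : Set Y, MeasurableSet K ∧ ν Kᶜ ≤ ENNReal.ofReal η ∧ ∃ Q : Y → Fin k,
      Measurable Q ∧ ∀ y ∈ K, ∀ z, dist z y ≤ r → Q z = P y := by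
  classical
  rcases isEmpty_or_nonempty Y with hY | ⟨⟨y₀⟩⟩
  · exact ⟨1, one_pos, univ, MeasurableSet.univ, by simp, P, hP, fun y => hY.elim y⟩
  have hk : 0 < k := (P y₀).pos
  have hηk : ENNReal.ofReal (η / k) ≠ 0 := by
    have : (0 : ℝ) < k := by exact_mod_cast hk
    simpa using div_pos hη this
  have hK : ∀ a : Fin k, ∃ K ⊆ P ⁻¹' {a}, IsCompact K ∧ ν (P ⁻¹' {a} \ K) < ENNReal.ofReal (η / k) :=
    fun a => (hP (measurableSet_singleton a)).exists_isCompact_sdiff_lt (measure_ne_top _ _) hηk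
  choose K hKP hKc hKν using hK
  have hdisj : ∀ a b : Fin k, a ≠ b → ∀ᶠ r in nhdsWithin (0 : ℝ) (Ioi 0),
      Disjoint (Metric.cthickening r (K a)) (Metric.cthickening r (K b)) := by
    intro a b hab
    have h1 : Disjoint (K a) (K b) := Set.disjoint_left.2 fun y hy hy' =>
      hab ((hKP a hy).symm.trans (hKP b hy'))
    obtain ⟨δ, hδ, hd⟩ := h1.exists_cthickenings (hKc a) (hKc b).isClosed
    filter_upwards [Ioo_mem_nhdsGT hδ] with r hr
    exact hd.mono (Metric.cthickening_mono hr.2.le _) (Metric.cthickening_mono hr.2.le _)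
  have hall : ∀ᶠ r in nhdsWithin (0 : ℝ) (Ioi 0), 0 < r ∧ ∀ a b : Fin k, a ≠ b →
      Disjoint (Metric.cthickening r (K a)) (Metric.cthickening r (K b)) := by
    refine (eventually_mem_nhdsWithin).and (eventually_all.2 fun a => eventually_all.2 fun b => ?_)
    by_cases hab : a = b
    · exact Eventually.of_forall fun r h => (h hab).elim
    · filter_upwards [hdisj a b hab] with r hr _ using hr
  obtain ⟨r, hr, hd⟩ := hall.exists
  let c : (Fin k → Prop) → Fin k := fun v => if h : ∃ a, v a then h.choose else P y₀
  let v : Y → Fin k → Prop := fun z a => z ∈ Metric.cthickening r (K a)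
  have hv : Measurable v := measurable_pi_lambda _ fun a =>
    measurable_mem.2 Metric.isClosed_cthickening.measurableSet
  refine ⟨r, hr, ⋃ a, K a, MeasurableSet.iUnion fun a => (hKc a).isClosed.measurableSet, ?_,
    c ∘ v, (measurable_of_countable c).comp hv, ?_⟩
  · have hsub : (⋃ a, K a)ᶜ ⊆ ⋃ a, (P ⁻¹' {a} \ K a) := fun y hy =>
      mem_iUnion.2 ⟨P y, rfl, fun h => hy (mem_iUnion.2 ⟨_, h⟩)⟩
    calc ν (⋃ a, K a)ᶜ ≤ ∑ a, ν (P ⁻¹' {a} \ K a) :=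
          (measure_mono hsub).trans (measure_iUnion_fintype_le _ _)
      _ ≤ ∑ _a : Fin k, ENNReal.ofReal (η / k) := Finset.sum_le_sum fun a _ => (hKν a).le
      _ = ENNReal.ofReal η := by
          rw [Finset.sum_const, Finset.card_univ, Fintype.card_fin, nsmul_eq_mul,
            ← ENNReal.ofReal_natCast, ← ENNReal.ofReal_mul (by positivity),
            mul_div_cancel₀ _ (by exact_mod_cast hk.ne')]
  · intro y hy z hz
    obtain ⟨a, ha⟩ := mem_iUnion.1 hy
    have hza : v z a := Metric.mem_cthickening_of_dist_le z y r _ ha hz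
    have hex : ∃ a, v z a := ⟨a, hza⟩
    have hPa : P y = a := hKP a ha
    show c (v z) = P y
    rw [hPa]
    simp only [c, dif_pos hex]
    by_contra hne
    exact Set.disjoint_left.1 (hd _ _ hne) hex.choose_spec hza

lemma exists_observable_dist_lt (Y : Type*) [MetricSpace Y] [CompactSpace Y] [MeasurableSpace Y]
    [BorelSpace Y] {ε : ℝ} (hε : 0 < ε) :
    ∃ (m : ℕ) (R : Y → Fin m → Prop), Measurable R ∧ ∀ z z', R z = R z' → dist z z' < ε := by
  obtain ⟨t, -, ht⟩ := isCompact_univ.elim_nhds_subcover (fun y : Y => Metric.ball y (ε / 2))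
    fun y _ => Metric.ball_mem_nhds y (half_pos hε)
  refine ⟨t.card, fun z i => z ∈ Metric.ball (t.equivFin.symm i : Y) (ε / 2),
    measurable_pi_lambda _ fun i => measurable_mem.2 Metric.isOpen_ball.measurableSet,
    fun z z' h => ?_⟩
  obtain ⟨c, hc, hz⟩ := mem_iUnion₂.1 (ht (mem_univ z))
  have h1 := congrFun h (t.equivFin ⟨c, hc⟩)
  simp only [Equiv.symm_apply_apply, eq_iff_iff] at h1
  have h2 := h1.1 hz
  rw [Metric.mem_ball] at hz h2
  have := dist_triangle_right z z' c
  linarith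

lemma entropyWrt_map_semiconj {Ω Ω' : Type*} [MeasurableSpace Ω] [MeasurableSpace Ω']
    {μ : Measure Ω} {f : Ω → Ω'} (hf : Measurable f) {G : Ω → Ω} {S : Ω' → Ω'} (hS : Measurable S)
    (hsemi : Function.Semiconj f G S) {α : Type*} [Fintype α] [MeasurableSpace α]
    [MeasurableSingletonClass α] {P : Ω' → α} (hP : Measurable P) :
    entropyWrt (μ.map f) S P = entropyWrt μ G (P ∘ f) := by
  unfold entropyWrt
  congr 1
  funext n
  rw [infoEntropy_map hf (measurable_itinerary hS hP n)]
  congr 2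
  funext x i
  simp only [Function.comp]
  rw [hsemi.iterate_right i x]

lemma infinitePi_eval_eq {E : Type*} [Fintype E] [MeasurableSpace E] [MeasurableSingletonClass E]
    {u : Measure E} [IsProbabilityMeasure u] (hu : ∀ c, u {c} = (Fintype.card E : ℝ≥0∞)⁻¹)
    {m : ℕ} {idx : Fin m → ℕ} (hidx : Function.Injective idx) (c : Fin m → E) :
    Measure.infinitePi (fun _ : ℕ => u) {ω | (fun l => ω (idx l)) = c}
      = ((Fintype.card E : ℝ≥0∞) ^ m)⁻¹ := by
  have hset : {ω : ℕ → E | (fun l => ω (idx l)) = c}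
      = Set.pi ((Finset.univ.map ⟨idx, hidx⟩ : Finset ℕ) : Set ℕ)
        fun i => {d | ∀ l, idx l = i → d = c l} := by
    ext ω
    simp only [mem_ofPred_eq, Set.mem_pi, Finset.mem_coe, Finset.mem_map, Finset.mem_univ, true_and,
      funext_iff, Function.Embedding.coeFn_mk]
    constructor
    · rintro h i - l rfl
      exact h l
    · exact fun h l => h _ ⟨l, rfl⟩ l rfl
  rw [hset, Measure.infinitePi_pi _ fun i _ => (Set.toFinite _).measurableSet, Finset.prod_map]
  have h1 : ∀ l : Fin m, u {d | ∀ l', idx l' = idx l → d = c l'} = (Fintype.card E : ℝ≥0∞)⁻¹ := by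
    intro l
    rw [← hu (c l)]
    congr 1
    ext d
    constructor
    · exact fun h => h l rfl
    · intro h l' hl'
      rw [hidx hl']
      exact h
  simp [h1, ENNReal.inv_pow]

lemma measure_inter_symbols_eq {Bx E Y : Type*} [MeasurableSpace Bx] [MeasurableSpace Y] [Fintype E]
    [MeasurableSpace E] [MeasurableSingletonClass E]
    {u : Measure E} [IsProbabilityMeasure u] (hu : ∀ c, u {c} = (Fintype.card E : ℝ≥0∞)⁻¹)
    {l : Measure Bx} [SFinite l] {Ξ : Measure ((Bx × (ℕ → E)) × Y)}
    (hΞ : Ξ.map Prod.fst = l.prod (Measure.infinitePi fun _ => u))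
    {R : Bx → Bx} {S : Y → Y} {D : Set Bx} (hD : MeasurableSet D)
    {m : ℕ} {idx : Fin m → ℕ} (hidx : Function.Injective idx) (c : Fin m → E) :
    Ξ ({x | (fun i => ((Prod.map (Prod.map R leftShift) S)^[idx i] x).1.2 0) = c} ∩
        {x | x.1.1 ∈ D})
      = ((Fintype.card E : ℝ≥0∞) ^ m)⁻¹ * Ξ {x | x.1.1 ∈ D} := by
  have hC : MeasurableSet {ω : ℕ → E | (fun l => ω (idx l)) = c} := by
    have : Measurable fun ω : ℕ → E => fun l => ω (idx l) :=
      measurable_pi_lambda _ fun l => measurable_pi_apply _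
    exact this (measurableSet_singleton c)
  have h1 : {x : (Bx × (ℕ → E)) × Y |
      (fun i => ((Prod.map (Prod.map R leftShift) S)^[idx i] x).1.2 0) = c} ∩ {x | x.1.1 ∈ D}
      = Prod.fst ⁻¹' (D ×ˢ {ω : ℕ → E | (fun l => ω (idx l)) = c}) := by
    ext x
    simp only [Prod.map_iterate, Prod.map_fst, Prod.map_snd, leftShift_iterate_apply, zero_add,
      mem_inter_iff, mem_ofPred_eq, mem_preimage, mem_prod]
    exact and_comm
  have h2 : {x : (Bx × (ℕ → E)) × Y | x.1.1 ∈ D} = Prod.fst ⁻¹' (D ×ˢ (univ : Set (ℕ → E))) := by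
    ext x
    simp
  rw [h1, h2, ← Measure.map_apply measurable_fst (hD.prod hC),
    ← Measure.map_apply measurable_fst (hD.prod MeasurableSet.univ), hΞ, Measure.prod_prod,
    Measure.prod_prod, infinitePi_eval_eq hu hidx, measure_univ, mul_one, mul_comm]

section Perturbation

variable {B : Type*} [TopologicalSpace B] [T2Space B] [CompactSpace B]
  [SecondCountableTopology B] [MeasurableSpace B] [BorelSpace B]
  {Y : Type*} [MetricSpace Y] [CompactSpace Y] [MeasurableSpace Y] [BorelSpace Y]

/-- Coupling with orbits that follow the given ones outside blocks of proportion `w / M`, and that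
carry freely chosen words from a separated set inside these blocks. -/
lemma exists_ergodic_coupling (S : Y ≃ₜ Y) {T : B → B} (hT : Continuous T) {π : B → Y}
    (hπ : Continuous π) (hsemi : Function.Semiconj π T S)
    {ξ : Measure B} [IsProbabilityMeasure ξ] (hξ : Ergodic T ξ)
    {ε ε₀ δ : ℝ} (hε : 0 < ε) (hδ : 2 * ε + ε₀ ≤ δ)
    {L : ℕ → ℕ} (hL : IsGapFunction S.toEquiv ε L) {M n₀ g w : ℕ} [NeZero M] (hn₀ : 0 < n₀)
    (hg : g = L M) (hw : w = n₀ + 2 * g) (hwM : w < M)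
    {N : ℕ} [NeZero N] (word : ZMod N → Y)
    (hword : ∀ c c', c ≠ c' → ∃ t < n₀, δ ≤ dist (S^[t] (word c)) (S^[t] (word c')))
    {k : ℕ} {P Q : Y → Fin k} (hP : Measurable P) (hQ : Measurable Q)
    {K : Set Y} (hK : MeasurableSet K) (hKQ : ∀ y ∈ K, ∀ z, dist z y ≤ 2 * ε → Q z = P y)
    {ρ : Type*} [Fintype ρ] [MeasurableSpace ρ] [MeasurableSingletonClass ρ] {R : Y → ρ}
    (hR : Measurable R) (hRε : ∀ z z', R z = R z' → dist z z' < ε₀)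
    {τ : ℝ} (hτ : ∀ b : Y → Fin (k + 1), Measurable b → (∀ y ∈ K, b y = Fin.last k) →
      infoEntropy (ξ.map π) b ≤ τ) :
    ∃ Ξ : Measure (B × Y), IsProbabilityMeasure Ξ ∧ Ergodic (Prod.map T S) Ξ ∧
      Ξ.map Prod.fst = ξ ∧
      Ξ {x | 2 * ε < dist (π x.1) x.2} ≤ ENNReal.ofReal (w / M) ∧
      Real.log N / M + entropyWrt (ξ.map π) S P ≤
        entropyWrt (Ξ.map Prod.snd) S (fun z => (Q z, R z)) + τ +
          infoEntropy (ξ.map π) (fun y => fun i : Fin w => P (S^[i] y)) / M := by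
  classical
  have hM : (0 : ℝ) < M := by exact_mod_cast NeZero.pos M
  have hSm : Measurable S := S.continuous.measurable
  have hpw : Measurable fun y => fun i : Fin w => P (S^[i] y) := measurable_itinerary hSm hP w
  obtain ⟨l, hlp, hl, hlξ, hlw⟩ := exists_ergodic_phaseMap_sum_le hT hξ M (hpw.comp hπ.measurable)
  let u : Measure (ZMod N) := (N : ℝ≥0∞)⁻¹ • Measure.count
  have hu : ∀ c, u {c} = (Fintype.card (ZMod N) : ℝ≥0∞)⁻¹ := fun c => by
    simp [u, ZMod.card]
  have hup : IsProbabilityMeasure u := ⟨by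
    have hN : (N : ℝ≥0∞) ≠ 0 := by exact_mod_cast NeZero.ne N
    simp only [u, Measure.smul_apply, Measure.count_univ, smul_eq_mul, ENat.card_eq_coe_fintype_card,
      ZMod.card]
    exact ENNReal.inv_mul_cancel hN (ENNReal.natCast_ne_top N)⟩
  obtain ⟨Θ, hΘp, hΘ, hΘl, hΘF⟩ := exists_ergodic_block_tracking S hT hπ hsemi hε hL hn₀ hg hw hwM
    u word hl
  let G : ((B × ZMod M) × (ℕ → ZMod N)) × Y → ((B × ZMod M) × (ℕ → ZMod N)) × Y :=
    Prod.map (Prod.map (phaseMap T M) leftShift) S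
  let b : ((B × ZMod M) × (ℕ → ZMod N)) × Y → B := fun x => x.1.1.1
  let f : ((B × ZMod M) × (ℕ → ZMod N)) × Y → B × Y := fun x => (b x, x.2)
  let φ : ((B × ZMod M) × (ℕ → ZMod N)) × Y → ZMod M := fun x => x.1.1.2
  have hm : Measurable fun x : ((B × ZMod M) × (ℕ → ZMod N)) × Y => x.1.1 :=
    measurable_fst.comp measurable_fst
  have hbm : Measurable b := measurable_fst.comp (measurable_fst.comp measurable_fst)
  have hφ : Measurable φ := measurable_snd.comp (measurable_fst.comp measurable_fst)
  have hf : Measurable f := hbm.prodMk measurable_snd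
  have hfst : Θ.map (fun x => x.1.1) = l := by
    have h1 : (fun x : ((B × ZMod M) × (ℕ → ZMod N)) × Y => x.1.1) = Prod.fst ∘ Prod.fst := rfl
    rw [h1, ← Measure.map_map measurable_fst measurable_fst, hΘl, Measure.map_fst_prod]
    simp
  have hbξ : Θ.map b = ξ := by
    have h1 : b = Prod.fst ∘ fun x => x.1.1 := rfl
    rw [h1, ← Measure.map_map measurable_fst hm]
    exact (congrArg (Measure.map Prod.fst) hfst).trans hlξ
  have hfsemi : Function.Semiconj f G (Prod.map T S) := fun x => rfl
  have hbsemi : Function.Semiconj b G T := fun x => rfl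
  have hzsemi : Function.Semiconj Prod.snd G S := fun x => rfl
  have hφG : ∀ x, φ (G x) = φ x + 1 := fun x => rfl
  have hTS : Measurable (Prod.map T S) := hT.measurable.prodMap hSm
  have hπξ : (Θ.map (π ∘ b)) = ξ.map π := by
    rw [← Measure.map_map hπ.measurable hbm, hbξ]
  have hπb : Measurable (π ∘ b) := hπ.measurable.comp hbm
  have hπsemi : Function.Semiconj (π ∘ b) G S := hsemi.comp_left hbsemi
  have hpos : ∀ i x, (π ∘ b) (G^[i] x) = S^[i] (π (b x)) := fun i x => hπsemi.iterate_right i x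
  have hitin : ∀ (n : ℕ) x, (fun i : Fin n => (P ∘ π ∘ b) (G^[i] x))
      = fun i : Fin n => P (S^[i] (π (b x))) := fun n x => funext fun i => congrArg P (hpos i x)
  have hzi : ∀ i (x : ((B × ZMod M) × (ℕ → ZMod N)) × Y), (G^[i] x).2 = S^[i] x.2 :=
    fun i x => hzsemi.iterate_right i x
  refine ⟨Θ.map f, Measure.isProbabilityMeasure_map hf.aemeasurable,
    MeasurePreserving.ergodic_of_ergodic_semiconj ⟨hf, rfl⟩ hΘ hTS hfsemi, ?_, ?_, ?_⟩
  · rw [Measure.map_map measurable_fst hf]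
    exact hbξ
  · have hms : MeasurableSet {x : B × Y | 2 * ε < dist (π x.1) x.2} :=
      (isOpen_lt continuous_const ((hπ.comp continuous_fst).dist continuous_snd)).measurableSet
    rw [Measure.map_apply hf hms]
    have h1 : Θ (f ⁻¹' {x : B × Y | 2 * ε < dist (π x.1) x.2}) ≤ Θ {x | (φ x).val < w} := by
      refine measure_mono_ae ?_
      filter_upwards [hΘF] with x hx hx2
      by_contra hxw
      have := hx.1 (not_lt.1 hxw)
      rw [dist_comm] at this
      exact absurd hx2 (not_lt.2 this)
    refine h1.trans ?_
    have h2 : Θ {x | (φ x).val < w} = l {p | p.2.val < w} := by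
      rw [← hfst, Measure.map_apply hm]
      · rfl
      · exact measurable_snd (Set.toFinite {s : ZMod M | s.val < w}).measurableSet
    have h3 : {p : B × ZMod M | p.2.val < w}
        ⊆ ⋃ i ∈ Finset.range w, {p | p.2 = ((i : ℕ) : ZMod M)} := by
      intro p hp
      simp only [mem_iUnion, Finset.mem_range]
      exact ⟨p.2.val, hp, (ZMod.natCast_zmod_val p.2).symm⟩
    rw [h2]
    refine (measure_mono h3).trans ((measure_biUnion_finset_le _ _).trans ?_)
    simp only [measure_phase_eq hl.toMeasurePreserving]
    rw [Finset.sum_const, Finset.card_range, nsmul_eq_mul, ENNReal.ofReal_div_of_pos hM,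
      ENNReal.ofReal_natCast, ENNReal.ofReal_natCast, div_eq_mul_inv]
  · have hQR : Measurable fun z => (Q z, R z) := hQ.prodMk hR
    let bb : Y → Fin (k + 1) := fun y => if y ∈ K then Fin.last k else (P y).castSucc
    have hbb : Measurable bb :=
      Measurable.ite hK measurable_const ((measurable_of_countable _).comp hP)
    have hent₁ : entropyWrt (ξ.map π) S P = entropyWrt Θ G (P ∘ π ∘ b) := by
      rw [← hπξ, entropyWrt_map_semiconj hπb hSm hπsemi hP]
    have hent₂ : entropyWrt ((Θ.map f).map Prod.snd) S (fun z => (Q z, R z))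
        = entropyWrt Θ G ((fun z => (Q z, R z)) ∘ Prod.snd) := by
      rw [Measure.map_map measurable_snd hf]
      exact entropyWrt_map_semiconj measurable_snd hSm hzsemi hQR
    have hcard : Real.log N = Real.log (Fintype.card (ZMod N)) := by rw [ZMod.card]
    rw [hent₁, hent₂, hcard]
    have hdec : ∃ dec : (Fin n₀ → Fin k × ρ) → ZMod N, ∀ᵐ x ∂Θ, φ x = 0 → x.1.2 0 =
        dec fun t : Fin n₀ => ((fun z => (Q z, R z)) ∘ Prod.snd) (G^[g + t] x) := by
      let good : (Fin n₀ → Fin k × ρ) → ZMod N → Y → Prop := fun v c z =>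
        (∀ t < n₀, dist (S^[g + t] z) (S^[t] (word c)) ≤ ε) ∧
          ∀ t : Fin n₀, R (S^[g + t] z) = (v t).2
      refine ⟨fun v => if h : ∃ c, ∃ z, good v c z then h.choose else 0, ?_⟩
      filter_upwards [hΘF] with x hx h0
      have hgood : good (fun t : Fin n₀ => ((fun z => (Q z, R z)) ∘ Prod.snd) (G^[g + t] x))
          (x.1.2 0) x.2 :=
        ⟨hx.2 h0, fun t => by simp only [Function.comp, hzi]⟩
      have hex : ∃ c, ∃ z, good
          (fun t : Fin n₀ => ((fun z => (Q z, R z)) ∘ Prod.snd) (G^[g + t] x)) c z :=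
        ⟨_, _, hgood⟩
      rw [dif_pos hex]
      by_contra hne
      obtain ⟨z', hz'⟩ := hex.choose_spec
      obtain ⟨t, ht, hd⟩ := hword _ _ hne
      have h1 := hgood.1 t ht
      have h2 := hz'.1 t ht
      have h3 := hRε _ _ ((hgood.2 ⟨t, ht⟩).trans (hz'.2 ⟨t, ht⟩).symm)
      have h4 := dist_triangle4_left (S^[g + t] x.2) (S^[g + t] z') (S^[t] (word (x.1.2 0)))
        (S^[t] (word hex.choose))
      simp only at h3
      linarith
    obtain ⟨dec, hdec⟩ := hdec
    refine log_card_div_add_entropyWrt_le (M := M) (w := w) (g := g) (φ := φ)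
      (e := fun x => x.1.2 0) (b := bb ∘ π ∘ b) hΘ.toMeasurePreserving hφ hφG (hP.comp hπb)
      (hQR.comp measurable_snd) (hbb.comp hπb) ?_ dec hdec (by omega) hwM
      (fun a c => Fin.lastCases (motive := fun _ => Fin k) a.1 id c) ?_ ?_ ?_
    · intro n m s v idx c hidx
      have hD : MeasurableSet {p : B × ZMod M |
          (fun i : Fin n => P (S^[i] (π p.1))) = v ∧ p.2 = s} :=
        (((measurable_itinerary hSm hP n).comp (hπ.measurable.comp measurable_fst))
          (measurableSet_singleton v)).inter (measurable_snd (measurableSet_singleton s))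
      have h1 : {x | (fun i : Fin n => (P ∘ π ∘ b) (G^[i] x)) = v ∧ φ x = s}
          = {x | x.1.1 ∈ {p : B × ZMod M |
              (fun i : Fin n => P (S^[i] (π p.1))) = v ∧ p.2 = s}} := by
        ext x
        rw [mem_ofPred_eq, hitin]
        rfl
      rw [h1]
      exact measure_inter_symbols_eq hu hΘl hD hidx c
    · filter_upwards [hΘF] with x hx hxw
      by_cases hxK : π (b x) ∈ K
      · have := hKQ _ hxK x.2 (hx.1 hxw)
        simp [bb, hxK, this]
      · simp [bb, hxK]
    · rw [← infoEntropy_map hπb hbb, hπξ]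
      exact hτ bb hbb fun y hy => by simp [bb, hy]
    · refine (le_of_eq (Finset.sum_congr rfl fun v _ => ?_)).trans (hlw.trans_eq ?_)
      · rw [← hfst, Measure.map_apply hm]
        · congr 4
          ext x
          show φ x = 0 ∧ (fun i : Fin w => (P ∘ π ∘ b) (G^[i] x)) = v ↔ _
          rw [hitin]
          rfl
        · exact (measurable_snd (measurableSet_singleton 0)).inter
            ((hpw.comp (hπ.measurable.comp measurable_fst)) (measurableSet_singleton v))
      · rw [infoEntropy_map hπ.measurable hpw]

end Perturbation

lemma four_mul_le_entropy_gain {h h' C n κ θ w l : ℝ} (hh : 0 ≤ h) (hd : 0 < h' - h)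
    (hC : 3 ≤ C) (hn : 0 < n) (hκ : 0 ≤ κ) (hκC : 8 * C * κ = h' - h) (hθ1 : θ ≤ 1)
    (hθh : θ * h ≤ (h' - h) / 4) (hw : w ≤ n * (1 + θ)) (hl : h' * n ≤ l) :
    4 * κ ≤ (l - w * (h + κ)) / (C * n) := by
  have hκd : κ ≤ (h' - h) / 8 := by nlinarith
  have h1 : w * (h + κ) ≤ n * (1 + θ) * (h + κ) := by gcongr
  have h2 : (1 + θ) * (h + κ) ≤ h + 2 * κ + (h' - h) / 4 := by nlinarith
  have h3 : n * ((1 + θ) * (h + κ)) ≤ n * (h + 2 * κ + (h' - h) / 4) := by gcongr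
  have h4 : n * (4 * C * κ) ≤ n * (h' - (h + 2 * κ + (h' - h) / 4)) := by
    gcongr
    linarith
  rw [le_div_iff₀ (by positivity)]
  linarith

section

variable {X : Type*} [MetricSpace X] [CompactSpace X] [MeasurableSpace X] [BorelSpace X]
  {Y : Type*} [MetricSpace Y] [CompactSpace Y] [MeasurableSpace Y] [BorelSpace Y]

set_option maxHeartbeats 1000000 in
lemma exists_ergodic_mem_nhds_ksEntropy_lt {T : X → X} (hT : Continuous T) (S : Y ≃ₜ Y)
    (hspec : AlmostWeakSpec S.toEquiv) (ξ : ProbabilityMeasure (X × Y))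
    (hξ : Ergodic (Prod.map T S) (ξ : Measure (X × Y)))
    (hfin : ksEntropy ((ξ : Measure (X × Y)).map Prod.snd) S ≠ ⊤)
    (hent : (ksEntropy ((ξ : Measure (X × Y)).map Prod.snd) S : EReal) < topEntropy S)
    {O : Set (ProbabilityMeasure (X × Y))} (hO : O ∈ nhds ξ) :
    ∃ ξ' ∈ O, Ergodic (Prod.map T S) (ξ' : Measure (X × Y)) ∧
      (ξ' : Measure (X × Y)).map Prod.fst = (ξ : Measure (X × Y)).map Prod.fst ∧
      ksEntropy ((ξ : Measure (X × Y)).map Prod.snd) S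
        < ksEntropy ((ξ' : Measure (X × Y)).map Prod.snd) S := by
  let ν : Measure Y := (ξ : Measure (X × Y)).map Prod.snd
  have hνp : IsProbabilityMeasure ν :=
    Measure.isProbabilityMeasure_map measurable_snd.aemeasurable
  have hSc : Continuous S := S.continuous
  have hTS : Continuous (Prod.map T S) := hT.prodMap hSc
  have hν : MeasurePreserving S ν ν := by
    refine ⟨hSc.measurable, ?_⟩
    have h1 : S ∘ Prod.snd = Prod.snd ∘ Prod.map T S := rfl
    rw [Measure.map_map hSc.measurable measurable_snd, h1,
      ← Measure.map_map measurable_snd hTS.measurable, hξ.toMeasurePreserving.map_eq]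
  set h : ℝ := (ksEntropy ν S).toReal with hh
  have hh0 : 0 ≤ h := ENNReal.toReal_nonneg
  have hhE : (h : EReal) < topEntropy S := by
    rwa [hh, EReal.coe_ennreal_toReal hfin]
  obtain ⟨ε₁, hε₁, hclose⟩ := exists_dist_map_mem ξ hO
    (W := (X × Y) × Y)
  obtain ⟨h', hh', δ, hδ, hfreq⟩ := exists_separated_of_lt_topEntropy hhE
  set d : ℝ := h' - h with hd
  have hd0 : 0 < d := sub_pos.2 hh'
  obtain ⟨C, hC3, hC⟩ : ∃ C : ℕ, 3 ≤ C ∧ 2 / (C : ℝ) ≤ ε₁ := by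
    obtain ⟨c, hc⟩ := exists_nat_ge (2 / ε₁)
    refine ⟨max 3 c, le_max_left _ _, ?_⟩
    have h3 : (0 : ℝ) < ((max 3 c : ℕ) : ℝ) := by
      have : 0 < max 3 c := by omega
      exact_mod_cast this
    rw [div_le_iff₀ h3, mul_comm, ← div_le_iff₀ hε₁]
    exact hc.trans (by exact_mod_cast le_max_right _ _)
  have hC0 : (3 : ℝ) ≤ C := by exact_mod_cast hC3
  set κ : ℝ := d / (8 * C) with hκ
  have hκ0 : 0 < κ := by positivity
  have hκC : 8 * C * κ = d := by rw [hκ]; field_simp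
  set θ : ℝ := min 1 (d / (4 * (h + 1))) with hθ
  have hθ0 : 0 < θ := by positivity
  have hθ1 : θ ≤ 1 := min_le_left _ _
  have hθh : θ * h ≤ d / 4 := by
    calc θ * h ≤ d / (4 * (h + 1)) * (h + 1) := by
          gcongr
          · exact min_le_right _ _
          · linarith
      _ = d / 4 := by field_simp
  obtain ⟨k, P, hP, hPe⟩ := exists_entropyWrt_gt hν hfin hκ0
  obtain ⟨η, hη, hηκ⟩ := exists_negMulLog_le (τ := κ / (k + 1)) (by positivity)
  obtain ⟨r, hr, K, hK, hνK, Q, hQ, hKQ⟩ := exists_stable_observable ν hP hη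
  obtain ⟨m, R, hR, hRε⟩ := exists_observable_dist_lt Y (ε := δ / 3) (by positivity)
  set ε : ℝ := min (min (δ / 3) (ε₁ / 2)) (r / 2) with hε
  have hε0 : 0 < ε := by positivity
  have hεδ : ε ≤ δ / 3 := (min_le_left _ _).trans (min_le_left _ _)
  have hεε : ε ≤ ε₁ / 2 := (min_le_left _ _).trans (min_le_right _ _)
  have hεr : ε ≤ r / 2 := min_le_right _ _
  obtain ⟨L, hL, hLlim⟩ := hspec ε hε0
  have hCn : Tendsto (fun n : ℕ => C * n) atTop atTop :=
    tendsto_id.const_mul_atTop' (by omega)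
  have hev₁ : ∀ᶠ n : ℕ in atTop, 2 * (L (C * n) : ℝ) ≤ θ * n := by
    filter_upwards [(hLlim.comp hCn).eventually_lt_const (u := θ / (2 * C)) (by positivity),
      eventually_gt_atTop 0] with n hn hn0
    have hn0' : (0 : ℝ) < n := by exact_mod_cast hn0
    simp only [Function.comp, Nat.cast_mul] at hn
    rw [div_lt_div_iff₀ (by positivity) (by positivity)] at hn
    have hC0' : (0 : ℝ) < C := by linarith
    have : (2 * (L (C * n) : ℝ)) * C < (θ * n) * C := by linarith
    exact (lt_of_mul_lt_mul_right this hC0'.le).le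
  have hev₂ : ∀ᶠ n : ℕ in atTop, ∀ w ≥ n,
      infoEntropy ν (fun y => fun i : Fin w => P (S^[i] y)) ≤ w * (h + κ) := by
    have hle := entropyWrt_le_toReal_ksEntropy hν hfin hP
    have h1 : ∀ᶠ w : ℕ in atTop,
        infoEntropy ν (fun y => fun i : Fin w => P (S^[i] y)) ≤ w * (h + κ) := by
      filter_upwards [(tendsto_infoEntropy_itinerary_div hν hP).eventually_lt_const
        (u := h + κ) (by linarith), eventually_gt_atTop 0] with w hw hw0
      have hw0' : (0 : ℝ) < w := by exact_mod_cast hw0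
      rw [div_lt_iff₀ hw0'] at hw
      linarith
    exact eventually_forall_ge_atTop.2 h1
  obtain ⟨n₀, ⟨E, hEcard, hE⟩, ⟨hLn, hHn⟩, hn₀⟩ :=
    (hfreq.and_eventually ((hev₁.and hev₂).and (eventually_gt_atTop 0))).exists
  have hn₀' : (0 : ℝ) < n₀ := by exact_mod_cast hn₀
  have hE0 : 0 < E.card := by
    have : (0 : ℝ) < E.card := (Real.exp_pos _).trans_le hEcard
    exact_mod_cast this
  have : NeZero E.card := ⟨hE0.ne'⟩
  have : NeZero (C * n₀) := ⟨(Nat.mul_pos (by omega) hn₀).ne'⟩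
  let eqv : ZMod E.card ≃ E := Fintype.equivOfCardEq (by rw [ZMod.card, Fintype.card_coe])
  set w : ℕ := n₀ + 2 * L (C * n₀) with hw
  have hwR : (w : ℝ) ≤ n₀ * (1 + θ) := by
    rw [hw]
    push_cast
    linarith
  have hMR : ((C * n₀ : ℕ) : ℝ) = C * n₀ := by push_cast; rfl
  have hwM : w < C * n₀ := by
    have h1 : (w : ℝ) < (C * n₀ : ℕ) := by
      rw [hMR]
      nlinarith
    exact_mod_cast h1
  obtain ⟨Ξ, hΞp, hΞ, hΞξ, hΞd, hΞe⟩ := exists_ergodic_coupling (B := X × Y) S hTS continuous_snd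
    (π := Prod.snd) (fun _ => rfl) hξ (δ := δ) (ε₀ := δ / 3) hε0 (by linarith) hL hn₀ rfl hw hwM
    (fun c => (eqv c : Y))
    (fun c c' hc => hE _ (eqv c).2 _ (eqv c').2 fun h => hc (eqv.injective (Subtype.ext h)))
    hP hQ hK (fun y hy z hz => hKQ y hy z (hz.trans (by linarith))) hR hRε (τ := κ) (by
      intro b hb hbK
      refine (infoEntropy_le_of_measure_ne_le hb (Fin.last k) hη.le hηκ
        ((measure_mono (show {y | b y ≠ Fin.last k} ⊆ Kᶜ from
          fun y hy hyK => hy (hbK y hyK))).trans hνK)).trans_eq ?_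
      rw [Fintype.card_fin]
      push_cast
      field_simp)
  let f : (X × Y) × Y → X × Y := fun x => (x.1.1, x.2)
  have hf : Measurable f := (measurable_fst.comp measurable_fst).prodMk measurable_snd
  let ξ' : ProbabilityMeasure (X × Y) :=
    ⟨Ξ.map f, Measure.isProbabilityMeasure_map hf.aemeasurable⟩
  have hsnd : (ξ' : Measure (X × Y)).map Prod.snd = Ξ.map Prod.snd :=
    Measure.map_map measurable_snd hf
  refine ⟨ξ', ?_, ?_, ?_, ?_⟩
  · refine hclose ξ' Ξ Prod.fst f hΞp measurable_fst hf hΞξ rfl ((measure_mono ?_).trans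
      (hΞd.trans (ENNReal.ofReal_le_ofReal ?_)))
    · intro x hx
      have h1 : dist x.1 (f x) = dist x.1.2 x.2 := by
        rw [Prod.dist_eq]
        simp [f]
      rw [mem_ofPred_eq, h1] at hx
      rw [mem_ofPred_eq]
      linarith
    · refine le_trans ?_ hC
      rw [hMR, div_le_div_iff₀ (by positivity) (by linarith)]
      have : (w : ℝ) * C ≤ (n₀ * 2) * C := by
        gcongr
        nlinarith
      linarith
  · exact MeasurePreserving.ergodic_of_ergodic_semiconj ⟨hf, rfl⟩ hΞ hTS.measurable fun _ => rfl
  · show (Ξ.map f).map Prod.fst = _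
    rw [← hΞξ, Measure.map_map measurable_fst hf, Measure.map_map measurable_fst measurable_fst]
    rfl
  · have hΞsnd : IsProbabilityMeasure (Ξ.map Prod.snd) :=
      Measure.isProbabilityMeasure_map measurable_snd.aemeasurable
    have hΞS : MeasurePreserving S (Ξ.map Prod.snd) (Ξ.map Prod.snd) := by
      refine ⟨hSc.measurable, ?_⟩
      have h1 : S ∘ Prod.snd = Prod.snd ∘ Prod.map (Prod.map T S) S := rfl
      rw [Measure.map_map hSc.measurable measurable_snd, h1,
        ← Measure.map_map measurable_snd (hTS.prodMap hSc).measurable,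
        hΞ.toMeasurePreserving.map_eq]
    have hgt : h < entropyWrt (Ξ.map Prod.snd) S (fun z => (Q z, R z)) := by
      have hlog : h' * n₀ ≤ Real.log E.card :=
        (Real.le_log_iff_exp_le (by exact_mod_cast hE0)).2 hEcard
      have hHw := hHn w (by omega)
      have h2 : 4 * κ ≤ (Real.log E.card - w * (h + κ)) / (C * n₀ : ℕ) := by
        rw [hMR]
        exact four_mul_le_entropy_gain hh0 hd0 hC0 hn₀' hκ0.le hκC hθ1 hθh hwR hlog
      have h3 : infoEntropy ν (fun y => fun i : Fin w => P (S^[i] y)) / (C * n₀ : ℕ)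
          ≤ w * (h + κ) / (C * n₀ : ℕ) := by gcongr
      rw [sub_div] at h2
      have h4 : Real.log E.card / (C * n₀ : ℕ) + entropyWrt ν S P
          ≤ entropyWrt (Ξ.map Prod.snd) S (fun z => (Q z, R z)) + κ +
            infoEntropy ν (fun y => fun i : Fin w => P (S^[i] y)) / (C * n₀ : ℕ) := hΞe
      linarith
    rw [hsnd]
    refine lt_of_lt_of_le ?_ (ofReal_entropyWrt_le_ksEntropy hΞS (hQ.prodMk hR))
    show ksEntropy ν S < _
    rw [← ENNReal.ofReal_toReal hfin]
    exact (ENNReal.ofReal_lt_ofReal_iff (hh0.trans_lt hgt)).2 hgt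

end

lemma exists_ergodic_mem_nhds_ksEntropy_lt_of_metrizableSpace {X : Type*} [TopologicalSpace X]
    [TopologicalSpace.MetrizableSpace X] [CompactSpace X] [MeasurableSpace X] [BorelSpace X]
    {Y : Type*} [MetricSpace Y] [CompactSpace Y] [MeasurableSpace Y] [BorelSpace Y]
    {T : X → X} (hT : Continuous T) (S : Y ≃ₜ Y) (hspec : AlmostWeakSpec S.toEquiv)
    (ξ : ProbabilityMeasure (X × Y)) (hξ : Ergodic (Prod.map T S) (ξ : Measure (X × Y)))
    (hent : (ksEntropy ((ξ : Measure (X × Y)).map Prod.snd) S : EReal) < topEntropy S)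
    {O : Set (ProbabilityMeasure (X × Y))} (hO : O ∈ nhds ξ) :
    ∃ ξ' ∈ O, Ergodic (Prod.map T S) (ξ' : Measure (X × Y)) ∧
      (ξ' : Measure (X × Y)).map Prod.fst = (ξ : Measure (X × Y)).map Prod.fst ∧
      ksEntropy ((ξ : Measure (X × Y)).map Prod.snd) S
        < ksEntropy ((ξ' : Measure (X × Y)).map Prod.snd) S := by
  let := TopologicalSpace.metrizableSpaceMetric X
  refine exists_ergodic_mem_nhds_ksEntropy_lt hT S hspec ξ hξ ?_ hent hO
  intro h
  rw [h] at hent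
  exact not_top_lt hent

/-- **Perturbation to increase marginal entropy.**  If `ξ ∈ M₀` and `V` is a
weak*-neighbourhood of `ξ` in `M₀`, then `V` contains a joining `ξ' ∈ M₀` whose `Y`-marginal
entropy strictly exceeds `h_μ(σX)`. -/
theorem perturbation_increasing_marginal_entropy
    (k : ℕ) (Xs : Set (ℤ → Fin k)) (hne : Xs.Nonempty) (hcl : IsClosed Xs)
    (hsinv : fullShift '' Xs = Xs) (hnontriv : ¬ Xs.Finite)
    (σX : ↥Xs ≃ ↥Xs) (hσ : ∀ x : ↥Xs, (σX x : ℤ → Fin k) = fullShift (x : ℤ → Fin k))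
    (μ : Measure ↥Xs) [IsProbabilityMeasure μ] (herg : Ergodic (⇑σX) μ)
    {Y : Type*} [MetricSpace Y] [CompactSpace Y] [MeasurableSpace Y] [BorelSpace Y]
    (S : Y ≃ₜ Y) (hspec : AlmostWeakSpec S.toEquiv)
    (hent : (ksEntropy μ (⇑σX) : EReal) < topEntropy (⇑S))
    (ξ : ProbabilityMeasure (↥Xs × Y)) (hξ : ξ ∈ joiningM0 Xs σX μ S)
    (V : Set (ProbabilityMeasure (↥Xs × Y))) (hV : V ∈ nhdsWithin ξ (joiningM0 Xs σX μ S)) :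
    ∃ ξ' : ProbabilityMeasure (↥Xs × Y), ξ' ∈ V ∧ ξ' ∈ joiningM0 Xs σX μ S ∧
      ksEntropy μ (⇑σX) < ksEntropy ((ξ' : Measure (↥Xs × Y)).map Prod.snd) (⇑S) := by
  obtain ⟨hfst, hξerg, hle⟩ := id hξ
  obtain ⟨O, hO, hOV⟩ := mem_nhdsWithin_iff_exists_mem_nhds_inter.1 hV
  rcases hle.lt_or_eq with hlt | heq
  · exact ⟨ξ, mem_of_mem_nhdsWithin hξ hV, hξ, hlt⟩
  have : CompactSpace ↥Xs := isCompact_iff_compactSpace.1 hcl.isCompact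
  have hσc : Continuous σX := by
    refine continuous_induced_rng.2 ?_
    have h1 : Subtype.val ∘ σX = fun x : ↥Xs => fullShift (x : ℤ → Fin k) := funext hσ
    rw [h1]
    exact continuous_pi fun n => (continuous_apply (n + 1)).comp continuous_subtype_val
  obtain ⟨ξ', hξO, hξ', hfst', hlt⟩ := exists_ergodic_mem_nhds_ksEntropy_lt_of_metrizableSpace
    hσc S hspec ξ hξerg (by rwa [← heq]) hO
  rw [← heq] at hlt
  have hmem : ξ' ∈ joiningM0 Xs σX μ S := ⟨hfst'.trans hfst, hξ', hlt.le⟩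
  exact ⟨ξ', hOV ⟨hξO, hmem⟩, hmem, hlt⟩
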